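/- Let μ be a singular cardinal with cf(μ) = ℵ₀. Suppose there is a strictly increasing sequence ⟨λ_n : n < ω⟩ of regular cardinals, each greater than ℵ₁, with supremum μ, together with a sequence ⟨f_α : α < μ⁺⁺⟩ witnessing μ⁺⁺ = tcf(∏_n λ_n, <_{J^bd_ω}). Then there exists a stationary family 𝒜 ⊆ [μ⁺]^{ℵ₀} that does not reflect in any uncountable set A ⊆ μ⁺ of cardinality ≤ μ. -/

import Mathlib

open Cardinal Set

namespace ReflSCH

/-- `[B]^{<ℵ₁}`: the family of subsets of `B` of cardinality `< ℵ₁`,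
i.e. the countable subsets of `B`. -/
def small (B : Set Ordinal.{0}) : Set (Set Ordinal.{0}) := {a | a ⊆ B ∧ a.Countable}

/-- `[B]^{ℵ₀}`: the countably infinite subsets of `B`. -/
def ctblInf (B : Set Ordinal.{0}) : Set (Set Ordinal.{0}) :=
  {a | a ⊆ B ∧ a.Countable ∧ a.Infinite}

/-- A family is closed if the union of every nonempty `⊆`-increasing chain of fewer
than `ℵ₁` (i.e. countably many) of its members belongs to it. -/
def ClosedFam (𝒜 : Set (Set Ordinal.{0})) : Prop :=
  ∀ D : Set (Set Ordinal.{0}), D ⊆ 𝒜 → D.Nonempty → IsChain (· ⊆ ·) D → D.Countable →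
    ⋃₀ D ∈ 𝒜

/-- A family is unbounded in `[B]^{<ℵ₁}` if every member of `[B]^{<ℵ₁}` is contained in
some member of the family. -/
def UnbFam (B : Set Ordinal.{0}) (𝒜 : Set (Set Ordinal.{0})) : Prop :=
  ∀ y ∈ small B, ∃ x ∈ 𝒜, y ⊆ x

/-- A club of `[B]^{<ℵ₁}`. -/
def ClubFam (B : Set Ordinal.{0}) (𝒜 : Set (Set Ordinal.{0})) : Prop :=
  𝒜 ⊆ small B ∧ ClosedFam 𝒜 ∧ UnbFam B 𝒜

/-- The family `𝒜` meets every club of `[B]^{<ℵ₁}`. -/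
def MeetsClubs (B : Set Ordinal.{0}) (𝒜 : Set (Set Ordinal.{0})) : Prop :=
  ∀ 𝒞 : Set (Set Ordinal.{0}), ClubFam B 𝒞 → (𝒜 ∩ 𝒞).Nonempty

/-- Stationarity in `[B]^{<ℵ₁}`. -/
def StatFam (B : Set Ordinal.{0}) (𝒜 : Set (Set Ordinal.{0})) : Prop :=
  𝒜 ⊆ small B ∧ MeetsClubs B 𝒜

/-- `𝒜` reflects in `B₂` iff `𝒜 ∩ [B₂]^{ℵ₀}` is stationary in `[B₂]^{<ℵ₁}`. -/
def Reflects (𝒜 : Set (Set Ordinal.{0})) (B₂ : Set Ordinal.{0}) : Prop :=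
  StatFam B₂ (𝒜 ∩ ctblInf B₂)

/-- `f <_{J^{bd}_ω} g`: `f n < g n` for all but finitely many `n`. -/
def ltBd (f g : ℕ → Ordinal.{0}) : Prop := ∃ m : ℕ, ∀ n ≥ m, f n < g n

/-- `⟨f_α : α < lam.ord⟩` witnesses `lam = tcf (∏_n lamseq n, <_{J^{bd}_ω})`:
each `f_α ∈ ∏_n lamseq n`, the sequence is `<_{J^{bd}_ω}`-increasing, and it is
cofinal in the product. -/
def TcfWitness (lam : Cardinal.{0}) (lamseq : ℕ → Cardinal.{0})
    (f : Ordinal.{0} → ℕ → Ordinal.{0}) : Prop :=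
  (∀ α < lam.ord, ∀ n : ℕ, f α n < (lamseq n).ord) ∧
  (∀ α < lam.ord, ∀ β < lam.ord, α < β → ltBd (f α) (f β)) ∧
  (∀ g : ℕ → Ordinal.{0}, (∀ n : ℕ, g n < (lamseq n).ord) → ∃ α < lam.ord, ltBd g (f α))

/-- The sequence `⟨f_i : i ∈ I⟩` is free. -/
def Free (I : Set Ordinal.{0}) (f : Ordinal.{0} → ℕ → Ordinal.{0}) : Prop :=
  ∃ nf : Ordinal.{0} → ℕ, ∀ i ∈ I, ∀ j ∈ I, i < j →
    ∀ n : ℕ, nf i ≤ n → nf j ≤ n → f i n < f j n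

section M1
theorem bdd (o : Ordinal.{0}) (ho : ℵ₀ ≤ o.cof) (S : Set Ordinal.{0})
    (h : #S < Cardinal.lift.{1,0} o.cof) (hS : ∀ x ∈ S, x < o) :
    ∃ γ < o, ∀ x ∈ S, x < γ := by
  have hlim : Order.IsSuccLimit o := Ordinal.one_lt_cof_iff.1 (Cardinal.one_lt_aleph0.trans_le ho)
  by_contra hcon
  push Not at hcon
  have h2 : Order.cof (Iio o) ≤ #S := by
    let T : Set (Iio o) := {x | x.1 ∈ S}
    have hT : IsCofinal T := by
      intro x
      obtain ⟨y, hy, hxy⟩ := hcon x.1 x.2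
      exact ⟨⟨y, hS y hy⟩, hy, hxy⟩
    refine (Order.cof_le hT).trans ?_
    refine Cardinal.mk_le_of_injective (f := fun t : T => (⟨t.1.1, t.2⟩ : S)) ?_
    intro a b hab
    simpa [Subtype.ext_iff] using hab
  rw [Ordinal.cof_Iio, ← Ordinal.lift_cof] at h2
  exact absurd h (not_lt.2 h2)

theorem bddi {ι : Type 1} (o : Ordinal.{0}) (ho : ℵ₀ ≤ o.cof) (T : Set ι) (g : ι → Ordinal.{0})
    (h : #T < Cardinal.lift.{1,0} o.cof) (hS : ∀ x ∈ T, g x < o) :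
    ∃ γ < o, ∀ x ∈ T, g x < γ := by
  obtain ⟨γ, h1, h2⟩ := bdd o ho (g '' T) (Cardinal.mk_image_le.trans_lt h)
    (by rintro _ ⟨x, hx, rfl⟩; exact hS x hx)
  exact ⟨γ, h1, fun x hx => h2 _ ⟨x, hx, rfl⟩⟩

theorem bddC (o : Ordinal.{0}) (ho : ℵ₀ < o.cof) (S : Set Ordinal.{0}) (hc : S.Countable)
    (hS : ∀ x ∈ S, x < o) : ∃ γ < o, ∀ x ∈ S, x < γ := by
  refine bdd o ho.le S (lt_of_le_of_lt (b := ℵ₀) ?_ ?_) hS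
  · exact Cardinal.le_aleph0_iff_set_countable.2 hc
  · exact Cardinal.aleph0_lt_lift.2 ho

theorem bddN (o : Ordinal.{0}) (ho : ℵ₀ < o.cof) (g : ℕ → Ordinal.{0})
    (hS : ∀ x, g x < o) : ∃ γ < o, ∀ x, g x < γ := by
  obtain ⟨γ, h1, h2⟩ := bddC o ho (range g) (countable_range g) (by rintro _ ⟨x, rfl⟩; exact hS x)
  exact ⟨γ, h1, fun x => h2 _ ⟨x, rfl⟩⟩

/-- part I hypotheses -/
structure H1 (μ : Cardinal.{0}) (L : ℕ → Cardinal.{0}) : Prop where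
  big : ℵ₀ < μ
  reg : ∀ n, (L n).IsRegular
  unc : ∀ n, ℵ₀ < L n
  mono : StrictMono L
  sup : ⨆ n, L n = μ

theorem H1.lt {μ L} (h : H1 μ L) (n : ℕ) : L n < μ := by
  refine lt_of_lt_of_le (h.mono (Nat.lt_succ_self n)) ?_
  rw [← h.sup]
  exact le_ciSup (Cardinal.bddAbove_of_small) (n+1)

theorem H1.cov {μ L} (h : H1 μ L) {c : Cardinal.{0}} (hc : c < μ) : ∃ n, c < L n := by
  rw [← h.sup] at hc
  exact exists_lt_of_lt_ciSup hc

theorem H1.cofL {μ L} (h : H1 μ L) (n : ℕ) : (L n).ord.cof = L n := (h.reg n).cof_ord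
theorem H1.cofLi {μ L} (h : H1 μ L) (n : ℕ) : ℵ₀ ≤ (L n).ord.cof := by
  rw [h.cofL]; exact (h.unc n).le

theorem H1.regS {μ L} (h : H1 μ L) : (Order.succ μ).IsRegular := Cardinal.isRegular_succ h.big.le
theorem H1.cofT {μ L} (h : H1 μ L) : (Order.succ μ).ord.cof = Order.succ μ := h.regS.cof_ord
theorem H1.cofTi {μ L} (h : H1 μ L) : ℵ₀ < (Order.succ μ).ord.cof := by
  rw [h.cofT]; exact h.big.trans (Order.lt_succ μ)

theorem mk_Iio' (o : Ordinal.{0}) : #(Iio o) = Cardinal.lift.{1,0} o.card := Cardinal.mk_Iio_ordinal o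

theorem exists_c {μ L} (h : H1 μ L) : ∃ c : Ordinal.{0} → Ordinal.{0} → ℕ,
    ∀ β < (Order.succ μ).ord, ∀ n, #{α | α < β ∧ c β α ≤ n} < Cardinal.lift.{1,0} (L n) := by
  have key : ∀ β : Ordinal.{0}, ∃ c : Ordinal.{0} → ℕ, β < (Order.succ μ).ord →
      ∀ n, #{α | α < β ∧ c α ≤ n} < Cardinal.lift.{1,0} (L n) := by
    intro β
    by_cases hβ : β < (Order.succ μ).ord
    swap
    · exact ⟨fun _ => 0, fun h => absurd h hβ⟩
    have h1 : β.card ≤ μ := by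
      rw [Cardinal.lt_ord] at hβ
      exact Order.lt_succ_iff.1 hβ
    have h2 : #(Iio β) ≤ #(Iio μ.ord) := by
      rw [mk_Iio', mk_Iio', Cardinal.card_ord]; exact Cardinal.lift_le.2 h1
    obtain ⟨e⟩ := h2
    have h3 : ∀ x : Iio μ.ord, ∃ n, x.1 < (L n).ord := by
      rintro ⟨x, hx⟩
      obtain ⟨n, hn⟩ := h.cov (Cardinal.lt_ord.1 hx)
      exact ⟨n, Cardinal.lt_ord.2 hn⟩
    choose d hd using h3
    classical
    refine ⟨fun α => if hα : α < β then d (e ⟨α, hα⟩) + 1 else 0, fun _ n => ?_⟩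
    rcases n with _ | n
    · have : {α | α < β ∧ (if hα : α < β then d (e ⟨α, hα⟩) + 1 else 0) ≤ 0} = ∅ := by
        ext α; simp only [mem_ofPred_eq, mem_empty_iff_false, iff_false]
        rintro ⟨h1, h2⟩; simp [h1] at h2
      rw [this]
      simp only [mk_eq_zero]
      exact lt_of_lt_of_le Cardinal.aleph0_pos (by simpa using (h.unc 0).le)
    · have : #{α | α < β ∧ (if hα : α < β then d (e ⟨α, hα⟩) + 1 else 0) ≤ n + 1}
          ≤ #(Iio (L n).ord) := by
        refine Cardinal.mk_le_of_injective (f := fun x => ⟨(e ⟨x.1, x.2.1⟩).1, ?_⟩) ?_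
        · have := x.2.2
          rw [dif_pos x.2.1] at this
          exact (hd _).trans_le (Cardinal.ord_le_ord.2 (h.mono.monotone (by omega)))
        · intro x y hxy
          have := e.injective (Subtype.ext (Subtype.mk.inj hxy))
          exact Subtype.ext (Subtype.mk.inj this)
      refine this.trans_lt ?_
      rw [mk_Iio', Cardinal.card_ord]
      exact Cardinal.lift_lt.2 (h.mono (Nat.lt_succ_self n))
  choose c hc using key
  exact ⟨c, fun β hβ n => hc β hβ n⟩

theorem free_seq {μ L} (h : H1 μ L) (f : Ordinal.{0} → ℕ → Ordinal.{0})
    (hf : TcfWitness (Order.succ (Order.succ μ)) L f) :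
    ∃ F : Ordinal.{0} → ℕ → Ordinal.{0},
      (∀ α < (Order.succ μ).ord, ∀ n, F α n < (L n).ord) ∧
      ∀ β < (Order.succ μ).ord, Free (Iio β) F := by
  classical
  obtain ⟨c, hc⟩ := exists_c h
  set θ := (Order.succ μ).ord with hθ
  let P (α : Ordinal.{0}) (rec : ∀ α' < α, ℕ → Ordinal.{0}) (g : ℕ → Ordinal.{0}) : Prop :=
    (∀ n, g n < (L n).ord) ∧ ∀ β < θ, ∃ m, ∀ n ≥ m, ∀ α' (hα : α' < α), α' < β → c β α' ≤ n →
      rec α' hα n < g n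
  let F : Ordinal.{0} → ℕ → Ordinal.{0} := Ordinal.lt_wf.fix (fun α rec =>
    if hx : ∃ g, P α rec g then hx.choose else fun _ => 0)
  have hF : ∀ α, F α = if hx : ∃ g, P α (fun α' _ => F α') g then hx.choose else fun _ => 0 :=
    fun α => Ordinal.lt_wf.fix_eq _ α
  have hex : ∀ α < θ, P α (fun α' _ => F α') (F α) := by
    intro α
    induction α using WellFoundedLT.induction with
    | ind α ih =>
      intro hα
      have : ∃ g, P α (fun α' _ => F α') g := by
        have h1 : ∀ β, ∃ ξ, β < θ → ξ < (Order.succ (Order.succ μ)).ord ∧ ∃ m, ∀ n ≥ m, ∀ α' (hα : α' < α), α' < β → c β α' ≤ n →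
            F α' n < f ξ n := by
          intro β
          by_cases hβ : β < θ
          swap
          · exact ⟨0, fun h => absurd h hβ⟩
          have h2 : ∀ n, ∃ γ < (L n).ord, ∀ x ∈ {α' | α' < β ∧ c β α' ≤ n} ∩ Iio α, F x n < γ := by
            intro n
            refine bddi _ (h.cofLi n) _ (fun x => F x n) ?_ ?_
            · rw [h.cofL]
              exact (Cardinal.mk_le_mk_of_subset inter_subset_left).trans_lt (hc β hβ n)
            · rintro x ⟨_, hx⟩
              exact (ih x hx (lt_trans hx hα)).1 n
          choose hh hh1 hh2 using h2
          obtain ⟨ξ, hξ, m, hm⟩ := hf.2.2 hh hh1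
          exact ⟨ξ, fun _ => ⟨hξ, m, fun n hn α' h1 h2 h3 => (hh2 n α' ⟨⟨h2, h3⟩, h1⟩).trans (hm n hn)⟩⟩
        choose ξ hξ using h1
        have hr : (Order.succ (Order.succ μ)).IsRegular :=
          Cardinal.isRegular_succ (h.big.le.trans (Order.le_succ μ))
        obtain ⟨γ, hγ, hγ2⟩ := bddi (Order.succ (Order.succ μ)).ord
          (by rw [hr.cof_ord]; exact hr.aleph0_le) (Iio θ) ξ
          (by rw [hr.cof_ord, mk_Iio', hθ, Cardinal.card_ord]; exact Cardinal.lift_lt.2 (Order.lt_succ _))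
          (fun x hx => (hξ x hx).1)
        refine ⟨f γ, hf.1 γ hγ, fun β hβ => ?_⟩
        obtain ⟨m, hm⟩ := (hξ β hβ).2
        obtain ⟨m', hm'⟩ := hf.2.1 _ (hξ β hβ).1 _ hγ (hγ2 β hβ)
        exact ⟨max m m', fun n hn α' h1 h2 h3 => (hm n (le_of_max_le_left hn) α' h1 h2 h3).trans
          (hm' n (le_of_max_le_right hn))⟩
      rw [hF, dif_pos this]
      exact this.choose_spec
  refine ⟨F, fun α hα => (hex α hα).1, fun β hβ => ?_⟩
  have h3 : ∀ α, ∃ m, α < β → ∀ n ≥ m, ∀ α' (hα : α' < α), α' < β → c β α' ≤ n → F α' n < F α n := by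
    intro α
    by_cases hα : α < β
    · obtain ⟨m, hm⟩ := (hex α (hα.trans hβ)).2 β hβ
      exact ⟨m, fun _ => hm⟩
    · exact ⟨0, fun h => absurd h hα⟩
  choose m hm using h3
  refine ⟨fun α => max (c β α) (m α), fun i hi j hj hij n hn1 hn2 => ?_⟩
  exact hm j hj n (le_of_max_le_right hn2) i hij hi (le_of_max_le_left hn1)

end M1

section M2
theorem pigeon (o : Ordinal.{0}) (ho : ℵ₀ < o.cof) (A : Set Ordinal.{0})
    (hA : ∀ x < o, ∃ a ∈ A, x ≤ a ∧ a < o) (T : Ordinal.{0} → ℕ) :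
    ∃ n, ∀ x < o, ∃ a ∈ A, T a = n ∧ x ≤ a ∧ a < o := by
  by_contra hcon
  push Not at hcon
  choose x hx hx2 using hcon
  obtain ⟨γ, hγ, hγ2⟩ := bddN o ho x hx
  obtain ⟨a, ha, h1, h2⟩ := hA γ hγ
  exact absurd h2 (not_lt.2 (hx2 (T a) a ha rfl ((hγ2 (T a)).le.trans h1)))

theorem card_unb (o : Ordinal.{0}) (ho : ℵ₀ ≤ o.cof) (A : Set Ordinal.{0})
    (hA : ∀ x < o, ∃ a ∈ A, x ≤ a ∧ a < o) : Cardinal.lift.{1,0} o.cof ≤ #(A ∩ Iio o : Set Ordinal.{0}) := by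
  by_contra hcon
  push Not at hcon
  obtain ⟨γ, hγ, hγ2⟩ := bdd o ho _ hcon (fun x hx => hx.2)
  obtain ⟨a, h1, h2, h3⟩ := hA γ hγ
  exact absurd (hγ2 a ⟨h1, h3⟩) (not_lt.2 h2)

/-- projection -/
noncomputable def pr (S : Set Ordinal.{0}) (x : Ordinal.{0}) : Ordinal.{0} := sInf {s | s ∈ S ∧ x ≤ s}

theorem pr_spec {S : Set Ordinal.{0}} {x s : Ordinal.{0}} (hs : s ∈ S) (hx : x ≤ s) :
    pr S x ∈ S ∧ x ≤ pr S x := csInf_mem (s := {s | s ∈ S ∧ x ≤ s}) ⟨s, hs, hx⟩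

theorem pr_le {S : Set Ordinal.{0}} {x s : Ordinal.{0}} (hs : s ∈ S) (hx : x ≤ s) : pr S x ≤ s :=
  csInf_le (OrderBot.bddBelow _) ⟨hs, hx⟩

theorem pr_mono {S : Set Ordinal.{0}} {x y s : Ordinal.{0}} (hs : s ∈ S) (hx : y ≤ s) (h : x ≤ y) :
    pr S x ≤ pr S y := by
  obtain ⟨h1, h2⟩ := pr_spec hs hx
  exact pr_le h1 (h.trans h2)

/-- hypotheses on F -/
structure H2 (μ : Cardinal.{0}) (L : ℕ → Cardinal.{0}) (F : Ordinal.{0} → ℕ → Ordinal.{0}) : Prop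
    extends H1 μ L where
  lt' : ∀ α < (Order.succ μ).ord, ∀ n, F α n < (L n).ord
  free : ∀ β < (Order.succ μ).ord, Free (Iio β) F

variable {μ : Cardinal.{0}} {L : ℕ → Cardinal.{0}} {F : Ordinal.{0} → ℕ → Ordinal.{0}}

theorem H1.succ_lt (h : H1 μ L) {x : Ordinal.{0}} (hx : x < (Order.succ μ).ord) :
    Order.succ x < (Order.succ μ).ord :=
  (Cardinal.isSuccLimit_ord (h.big.le.trans (Order.le_succ μ))).succ_lt hx

theorem H2.inc (h : H2 μ L F) {i j : Ordinal.{0}} (hij : i < j) (hj : j < (Order.succ μ).ord) :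
    ltBd (F i) (F j) := by
  obtain ⟨nf, hnf⟩ := h.free _ (h.succ_lt hj)
  refine ⟨max (nf i) (nf j), fun n hn => ?_⟩
  exact hnf i (hij.trans (Order.lt_succ j)) j (Order.lt_succ j) hij n (le_of_max_le_left hn)
    (le_of_max_le_right hn)

theorem seqrec (h : H1 μ L) (nx : Ordinal.{0} → Ordinal.{0})
    (hnx : ∀ x < (Order.succ μ).ord, nx x < (Order.succ μ).ord) :
    ∃ x : Ordinal.{0} → Ordinal.{0}, ∀ ν < (Order.succ μ).ord, x ν < (Order.succ μ).ord ∧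
      ∀ η < ν, nx (x η) < x ν := by
  classical
  set θ := (Order.succ μ).ord with hθ
  let P (α : Ordinal.{0}) (rec : ∀ α' < α, Ordinal.{0}) (g : Ordinal.{0}) : Prop :=
    g < θ ∧ ∀ η (hη : η < α), nx (rec η hη) < g
  let F : Ordinal.{0} → Ordinal.{0} := Ordinal.lt_wf.fix (fun α rec =>
    if hx : ∃ g, P α rec g then hx.choose else 0)
  have hF : ∀ α, F α = if hx : ∃ g, P α (fun α' _ => F α') g then hx.choose else 0 :=
    fun α => Ordinal.lt_wf.fix_eq _ α
  refine ⟨F, fun ν => ?_⟩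
  induction ν using WellFoundedLT.induction with
  | ind ν ih =>
    intro hν
    have : ∃ g, P ν (fun α' _ => F α') g := by
      obtain ⟨γ, h1, h2⟩ := bddi θ h.cofTi.le (Iio ν) (fun η => nx (F η)) (by
        rw [h.cofT, mk_Iio']; exact Cardinal.lift_lt.2 (Cardinal.lt_ord.1 hν))
        (fun η hη => hnx _ (ih η hη (lt_trans hη hν)).1)
      exact ⟨γ, h1, h2⟩
    rw [hF, dif_pos this]
    exact this.choose_spec

theorem H2.bpp (h : H2 μ L F) (m : ℕ) (S : ℕ → Set Ordinal.{0})
    (hS : ∀ n, #(S n) < Cardinal.lift.{1,0} (L m)) (hL : ∀ n, (L n).ord ∈ S n) :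
    ∃ ξ < (Order.succ μ).ord, ∀ ξ' < (Order.succ μ).ord,
      ∃ k, ∀ n ≥ k, F ξ' n < pr (S n) (F ξ n) := by
  set θ := (Order.succ μ).ord with hθ
  have hpr : ∀ ξ < θ, ∀ n, pr (S n) (F ξ n) ∈ S n ∧ F ξ n ≤ pr (S n) (F ξ n) :=
    fun ξ hξ n => pr_spec (hL n) (h.lt' ξ hξ n).le
  by_contra hcon
  have h1 : ∀ ξ, ∃ ξ', ξ < θ → ξ < ξ' ∧ ξ' < θ ∧ ∀ k, ∃ n ≥ k, pr (S n) (F ξ n) < F ξ' n := by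
    intro ξ
    by_contra hc
    push Not at hc
    apply hcon
    refine ⟨ξ, (hc 0).1, fun ξ' hξ' => ?_⟩
    have hξ := (hc 0).1
    obtain ⟨k0, hk0⟩ := (hc (Order.succ (max ξ ξ'))).2
      (Order.lt_succ_iff.2 (le_max_left _ _)) (h.succ_lt (max_lt hξ hξ'))
    obtain ⟨k1, hk1⟩ := h.inc (i := ξ') (Order.lt_succ_iff.2 (le_max_right ξ ξ')) (h.succ_lt (max_lt hξ hξ'))
    exact ⟨max k0 k1, fun n hn => (hk1 n (le_of_max_le_right hn)).trans_le (hk0 n (le_of_max_le_left hn))⟩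
  choose nx hnx using h1
  obtain ⟨x, hx⟩ := seqrec h.toH1 nx (fun ξ hξ => (hnx ξ hξ).2.1)
  have hκθ : (L m).ord < θ := Cardinal.ord_lt_ord.2 ((h.lt m).trans (Order.lt_succ μ))
  obtain ⟨j, hj, hjx⟩ : ∃ j < θ, ∀ ν < (L m).ord, nx (x ν) < j :=
    bddi θ h.cofTi.le (Iio (L m).ord) (fun ν => nx (x ν))
      (by rw [h.cofT, mk_Iio', Cardinal.card_ord]; exact Cardinal.lift_lt.2 ((h.lt m).trans (Order.lt_succ μ)))
      (fun ν hν => (hnx _ (hx ν (lt_trans hν hκθ)).1).2.1)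
  obtain ⟨nf, hnf⟩ := h.free j hj
  have h2 : ∀ ν, ∃ n, ν < (L m).ord → nf (x ν) ≤ n ∧ nf (nx (x ν)) ≤ n ∧
      pr (S n) (F (x ν) n) < F (nx (x ν)) n := by
    intro ν
    by_cases hν : ν < (L m).ord
    · obtain ⟨n, hn, hn2⟩ := (hnx _ (hx ν (lt_trans hν hκθ)).1).2.2 (max (nf (x ν)) (nf (nx (x ν))))
      exact ⟨n, fun _ => ⟨le_of_max_le_left hn, le_of_max_le_right hn, hn2⟩⟩
    · exact ⟨0, fun h => absurd h hν⟩
  choose T hT using h2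
  have hcu : ℵ₀ < (L m).ord.cof := by rw [h.cofL]; exact h.unc m
  obtain ⟨n, hn⟩ := pigeon (L m).ord hcu univ (fun x hx => ⟨x, trivial, le_rfl, hx⟩) T
  have h3 := card_unb (L m).ord hcu.le {ν | T ν = n} (by simpa using hn)
  rw [h.cofL] at h3
  refine absurd (h3.trans ?_) (not_le.2 (hS n))
  have hmon : ∀ ν < (L m).ord, ∀ η < ν, T ν = n → T η = n →
      pr (S n) (F (x η) n) < pr (S n) (F (x ν) n) := by
    intro ν hν η hη h4 h5
    have hηκ := hη.trans hν
    have a1 := (hT η hηκ); have a2 := hT ν hν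
    rw [h5] at a1; rw [h4] at a2
    have a3 : F (nx (x η)) n < F (x ν) n :=
      hnf _ (hjx η hηκ) _ ((hnx _ (hx ν (hν.trans hκθ)).1).1.trans (hjx ν hν))
        ((hx ν (hν.trans hκθ)).2 η hη) n a1.2.1 a2.1
    exact (a1.2.2.trans a3).trans_le (hpr _ (hx ν (hν.trans hκθ)).1 n).2
  refine Cardinal.mk_le_of_injective (f := fun v => ⟨pr (S n) (F (x v.1) n),
    (hpr _ (hx v.1 (lt_trans v.2.2 hκθ)).1 n).1⟩) ?_
  intro a b hab
  have hab := Subtype.mk.inj hab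
  rcases lt_trichotomy a.1 b.1 with h4 | h4 | h4
  · exact absurd hab (hmon _ b.2.2 _ h4 b.2.1 a.2.1).ne
  · exact Subtype.ext h4
  · exact absurd hab (hmon _ a.2.2 _ h4 a.2.1 b.2.1).ne'

/-- upper bound -/
def UB (μ : Cardinal.{0}) (F : Ordinal.{0} → ℕ → Ordinal.{0}) (g : ℕ → Ordinal.{0}) : Prop :=
  ∀ ξ < (Order.succ μ).ord, ltBd (F ξ) g
/-- exact -/
def Exact (μ : Cardinal.{0}) (F : Ordinal.{0} → ℕ → Ordinal.{0}) (g : ℕ → Ordinal.{0}) : Prop :=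
  ∀ h, ltBd h g → ∃ ξ < (Order.succ μ).ord, ltBd h (F ξ)

theorem H2.improve (h : H2 μ L F) (g : ℕ → Ordinal.{0}) (hg : UB μ F g) (hne : ¬ Exact μ F g) :
    ∃ g', UB μ F g' ∧ (∀ n, g' n ≤ g n) ∧ ∀ k, ∃ n ≥ k, g' n < g n := by
  unfold Exact at hne
  push Not at hne
  obtain ⟨u, hu, hu2⟩ := hne
  obtain ⟨ξ, hξ, hp⟩ := h.bpp 0 (fun n => {u n, g n, (L n).ord}) (fun n => by
    refine lt_of_lt_of_le (b := ℵ₀) ?_ (by simpa using (h.unc 0).le)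
    exact Cardinal.lt_aleph0_iff_set_finite.2 (by simp)) (fun n => by simp)
  refine ⟨fun n => min (pr {u n, g n, (L n).ord} (F ξ n)) (g n), ?_, fun n => min_le_right _ _, ?_⟩
  · intro ξ' hξ'
    obtain ⟨k, hk⟩ := hp ξ' hξ'
    obtain ⟨k', hk'⟩ := hg ξ' hξ'
    exact ⟨max k k', fun n hn => lt_min (hk n (le_of_max_le_left hn)) (hk' n (le_of_max_le_right hn))⟩
  · intro k
    have := hu2 ξ hξ
    unfold ltBd at this
    push Not at this
    obtain ⟨k', hk'⟩ := hu
    obtain ⟨n, hn, hn2⟩ := this (max k k')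
    refine ⟨n, le_of_max_le_left hn, ?_⟩
    refine (min_le_left _ _).trans_lt (lt_of_le_of_lt ?_ (hk' n (le_of_max_le_right hn)))
    exact pr_le (by simp) hn2

theorem H2.eub (h : H2 μ L F) (hL1 : ∀ n, Cardinal.aleph 1 < L n) :
    ∃ g, UB μ F g ∧ Exact μ F g ∧ ∀ n, g n ≤ (L n).ord := by
  classical
  by_contra hcon
  push Not at hcon
  set θ := (Order.succ μ).ord with hθ
  set w1 := (Cardinal.aleph 1).ord with hw1
  let S (ν : Ordinal.{0}) (rec : ∀ η < ν, (Ordinal.{0} × (ℕ → Ordinal.{0}))) (n : ℕ) : Set Ordinal.{0} :=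
    insert (L n).ord {s | ∃ η, ∃ hη : η < ν, s = (rec η hη).2 n}
  let P (ν : Ordinal.{0}) (rec : ∀ η < ν, (Ordinal.{0} × (ℕ → Ordinal.{0})))
      (q : Ordinal.{0} × (ℕ → Ordinal.{0})) : Prop :=
    q.1 < θ ∧ UB μ F q.2 ∧ (∀ k, ∃ n ≥ k, q.2 n < pr (S ν rec n) (F q.1 n))
  have hw1r : (Cardinal.aleph 1).IsRegular := Cardinal.isRegular_aleph_one
  have hlt1 : ∀ ν < w1, (Iio ν).Countable := by
    intro ν hν
    rw [← Cardinal.le_aleph0_iff_set_countable, mk_Iio', Cardinal.lift_le_aleph0]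
    rw [hw1, Cardinal.lt_ord, ← Cardinal.succ_aleph0] at hν
    exact Order.lt_succ_iff.1 hν
  have hP : ∀ ν < w1, ∀ rec, ∃ q, P ν rec q := by
    intro ν hν rec
    obtain ⟨ξ, hξ, hp⟩ := h.bpp 0 (S ν rec) (fun n => by
      refine lt_of_le_of_lt (b := ℵ₀) ?_ (Cardinal.aleph0_lt_lift.2 (h.unc 0))
      rw [Cardinal.le_aleph0_iff_set_countable]
      apply Set.Countable.insert
      haveI := (hlt1 ν hν).to_subtype
      refine (countable_range (fun η : Iio ν => (rec η.1 η.2).2 n)).mono ?_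
      rintro s ⟨η, hη, rfl⟩
      exact ⟨⟨η, hη⟩, rfl⟩) (fun n => mem_insert _ _)
    have hne : ¬ Exact μ F (fun n => pr (S ν rec n) (F ξ n)) := by
      intro he
      obtain ⟨n, hn⟩ := hcon _ hp he
      exact absurd hn (not_lt.2 (pr_le (mem_insert _ _) (h.lt' ξ hξ n).le))
    obtain ⟨g', h1, h2, h3⟩ := h.improve _ hp hne
    exact ⟨(ξ, g'), hξ, h1, h3⟩
  let Q : Ordinal.{0} → (Ordinal.{0} × (ℕ → Ordinal.{0})) := Ordinal.lt_wf.fix (fun α rec =>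
    if hx : ∃ g, P α rec g then hx.choose else (0, fun _ => 0))
  have hQ : ∀ α, Q α = if hx : ∃ g, P α (fun α' _ => Q α') g then hx.choose else (0, fun _ => 0) :=
    fun α => Ordinal.lt_wf.fix_eq _ α
  have hQP : ∀ ν < w1, P ν (fun α' _ => Q α') (Q ν) := by
    intro ν hν
    rw [hQ, dif_pos (hP ν hν _)]
    exact (hP ν hν _).choose_spec
  let S' (ν : Ordinal.{0}) (n : ℕ) : Set Ordinal.{0} := S ν (fun η _ => Q η) n
  have hS'mono : ∀ n ν ν', ν ≤ ν' → S' ν n ⊆ S' ν' n := by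
    intro n ν ν' hν
    apply insert_subset_insert
    rintro s ⟨η, hη, rfl⟩
    exact ⟨η, hη.trans_le hν, rfl⟩
  have hw1μ : Cardinal.aleph 1 < Order.succ μ := ((hL1 0).trans (h.lt 0)).trans (Order.lt_succ μ)
  obtain ⟨X, hX, hX2⟩ := bddi θ h.cofTi.le (Iio w1) (fun ν => (Q ν).1)
    (by rw [h.cofT, mk_Iio', Cardinal.card_ord]; exact Cardinal.lift_lt.2 hw1μ)
    (fun ν hν => (hQP ν hν).1)
  have hst : ∀ n, ∃ ν < w1, ∀ ν' < w1, pr (S' ν n) (F X n) ≤ pr (S' ν' n) (F X n) := by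
    intro n
    have hne : ((fun ν => pr (S' ν n) (F X n)) '' (Iio w1)).Nonempty := ⟨_, 0, by
      show 0 < w1
      rw [hw1]; exact hw1r.ord_pos, rfl⟩
    obtain ⟨ν, hν, h1⟩ := csInf_mem hne
    refine ⟨ν, hν, fun ν' hν' => ?_⟩
    simp only at h1
    rw [h1]
    exact csInf_le (OrderBot.bddBelow _) ⟨ν', hν', rfl⟩
  choose N hN hN2 using hst
  have hw1c : ℵ₀ < w1.cof := by rw [hw1, hw1r.cof_ord]; exact Cardinal.aleph0_lt_aleph_one
  obtain ⟨ν, hν, hν2⟩ := bddN w1 hw1c N hN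
  have hsν : Order.succ ν < w1 :=
    (Cardinal.isSuccLimit_ord (Cardinal.aleph0_lt_aleph_one.le)).succ_lt hν
  obtain ⟨_, hub, hinf⟩ := hQP ν hν
  obtain ⟨k1, hk1⟩ := h.inc (hX2 ν hν) hX
  obtain ⟨k2, hk2⟩ := hub X hX
  obtain ⟨n, hn, hn2⟩ := hinf (max k1 k2)
  have e1 : pr (S' ν n) (F (Q ν).1 n) ≤ pr (S' ν n) (F X n) :=
    pr_mono (mem_insert _ _) (h.lt' X hX n).le (hk1 n (le_of_max_le_left hn)).le
  have e2 : pr (S' ν n) (F X n) ≤ pr (S' (N n) n) (F X n) := by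
    obtain ⟨a, b⟩ := pr_spec (S := S' (N n) n) (mem_insert _ _) (h.lt' X hX n).le
    exact pr_le (hS'mono n _ _ (hν2 n).le a) b
  have e3 := hN2 n _ hsν
  have e4 : pr (S' (Order.succ ν) n) (F X n) ≤ (Q ν).2 n :=
    pr_le (mem_insert_of_mem _ ⟨ν, Order.lt_succ ν, rfl⟩) (hk2 n (le_of_max_le_right hn)).le
  exact absurd hn2 (not_lt.2 (e1.trans (e2.trans (e3.trans e4))))

theorem exists_cofinal (o : Ordinal.{0}) : ∃ C : Set Ordinal.{0}, #C = Cardinal.lift.{1,0} o.cof ∧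
    (∀ x ∈ C, x < o) ∧ ∀ x < o, ∃ c ∈ C, x ≤ c := by
  obtain ⟨T, hT, hT2⟩ := Order.exists_cof_eq (Iio o)
  refine ⟨Subtype.val '' T, ?_, ?_, ?_⟩
  · rw [Cardinal.mk_image_eq Subtype.val_injective, hT2, Ordinal.cof_Iio, ← Ordinal.lift_cof]
  · rintro _ ⟨x, _, rfl⟩; exact x.2
  · intro x hx
    obtain ⟨c, hc, hxc⟩ := hT ⟨x, hx⟩
    exact ⟨c.1, ⟨c, hc, rfl⟩, hxc⟩

theorem H2.cofg (h : H2 μ L F) (g : ℕ → Ordinal.{0}) (hg : UB μ F g) (he : Exact μ F g)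
    (hgL : ∀ n, g n ≤ (L n).ord) (m : ℕ) : ∃ k, ∀ n ≥ k, L m ≤ (g n).cof := by
  classical
  by_contra hcon
  push Not at hcon
  have hθ : 0 < (Order.succ μ).ord := h.regS.ord_pos
  choose C hC1 hC2 hC3 using exists_cofinal
  let S : ℕ → Set Ordinal.{0} := fun n => insert (L n).ord (if (g n).cof < L m then C (g n) else ∅)
  obtain ⟨ξ, hξ, hp⟩ := h.bpp m S (fun n => by
    have hi : ℵ₀ < Cardinal.lift.{1,0} (L m) := Cardinal.aleph0_lt_lift.2 (h.unc m)
    refine (Cardinal.mk_insert_le).trans_lt (Cardinal.add_lt_of_lt hi.le ?_ (Cardinal.one_lt_aleph0.trans hi))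
    split_ifs with hc
    · rw [hC1]; exact Cardinal.lift_lt.2 hc
    · simpa using (Cardinal.aleph0_pos.trans hi)) (fun n => mem_insert _ _)
  let u : ℕ → Ordinal.{0} := fun n => if pr (S n) (F ξ n) < g n then pr (S n) (F ξ n) else 0
  obtain ⟨k0, hk0⟩ := hg ξ hξ
  obtain ⟨ξ', hξ', k1, hk1⟩ := he u ⟨k0, fun n hn => by
    simp only [u]; split_ifs with hc
    · exact hc
    · exact (zero_le).trans_lt (hk0 n hn)⟩
  obtain ⟨k2, hk2⟩ := hp ξ' hξ'
  obtain ⟨n, hn, hn2⟩ := hcon (max k0 (max k1 k2))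
  have l0 := hk0 n (by omega); have l1 := hk1 n (by omega); have l2 := hk2 n (by omega)
  obtain ⟨c, hc, hc2⟩ := hC3 (g n) (F ξ n) l0
  have : pr (S n) (F ξ n) < g n :=
    (pr_le (by simp only [S, if_pos hn2]; exact mem_insert_of_mem _ hc) hc2).trans_lt (hC2 _ c hc)
  simp only [u, if_pos this] at l1
  exact absurd l1 (not_lt.2 l2.le)

end M2

section M3
/-- part II hypotheses -/
structure H3 (μ : Cardinal.{0}) (G : ℕ → Ordinal.{0}) (f : Ordinal.{0} → ℕ → Ordinal.{0}) : Prop where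
  big : ℵ₀ < μ
  G1 : ∀ k, ℵ₀ < (G k).cof
  G2 : ∀ k, (G k).card < (G (k + 1)).cof
  G3 : ∀ k, G k < (Order.succ μ).ord
  f0 : ∀ i < (Order.succ μ).ord, ∀ k, f i k < G k
  f1 : ∀ i j, i < j → j < (Order.succ μ).ord → ltBd (f i) (f j)
  f2 : ∀ j < (Order.succ μ).ord, Free (Iio j) f
  f3 : ∀ h : ℕ → Ordinal.{0}, (∀ k, h k < G k) → ∃ i < (Order.succ μ).ord, ltBd h (f i)

theorem H2.toH3 {μ L F} (h : H2 μ L F) (hL1 : ∀ n, Cardinal.aleph 1 < L n) : ∃ G f, H3 μ G f := by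
  classical
  obtain ⟨g, hg, he, hgL⟩ := h.eub hL1
  choose K hK using h.cofg g hg he hgL
  let N : ℕ → ℕ := fun k => Nat.rec (K 0) (fun _ n => max (n + 1) (K (n + 1))) k
  have hN : ∀ k, N (k + 1) = max (N k + 1) (K (N k + 1)) := fun k => rfl
  have hNm : StrictMono N := strictMono_nat_of_lt_succ (fun k => by rw [hN]; omega)
  have hNk : ∀ k, k ≤ N k := hNm.id_le
  have hc : ∀ k, L (N k + 1) ≤ (g (N (k + 1))).cof := fun k => hK _ _ (by rw [hN]; omega)
  have hpos : ∀ k, ℵ₀ < (g (N k)).cof := by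
    intro k
    rcases k with _ | k
    · exact (h.unc 0).trans_le (hK 0 _ le_rfl)
    · exact (h.unc _).trans_le (hc k)
  have hpos2 : ∀ k, 0 < g (N k) := by
    intro k
    rw [pos_iff_ne_zero]
    intro h0
    have := hpos k
    rw [h0] at this
    simp at this
  refine ⟨fun k => g (N k), fun i k => if F i (N k) < g (N k) then F i (N k) else 0, ?_⟩
  have hev : ∀ i < (Order.succ μ).ord, ∃ m, ∀ k ≥ m, F i (N k) < g (N k) := by
    intro i hi
    obtain ⟨m, hm⟩ := hg i hi
    exact ⟨m, fun k hk => hm _ (hk.trans (hNk k))⟩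
  refine ⟨h.big, hpos, ?_, ?_, ?_, ?_, ?_, ?_⟩
  · intro k
    have h1 : (g (N k)).card ≤ L (N k) := by
      have := Ordinal.card_le_card (hgL (N k))
      rwa [Cardinal.card_ord] at this
    exact (h1.trans_lt (h.mono (Nat.lt_succ_self _))).trans_le (hc k)
  · intro k
    exact (hgL _).trans_lt (Cardinal.ord_lt_ord.2 ((h.lt _).trans (Order.lt_succ μ)))
  · intro i _ k

    split_ifs with h1
    · exact h1
    · exact hpos2 k
  · intro i j hij hj
    obtain ⟨m1, hm1⟩ := hev i (hij.trans hj)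
    obtain ⟨m2, hm2⟩ := hev j hj
    obtain ⟨m3, hm3⟩ := h.inc hij hj
    refine ⟨max m1 (max m2 m3), fun k hk => ?_⟩
    beta_reduce
    rw [if_pos (hm1 k (by omega)), if_pos (hm2 k (by omega))]
    exact hm3 _ ((show m3 ≤ k by omega).trans (hNk k))
  · intro j hj
    obtain ⟨nf, hnf⟩ := h.free j hj
    choose! M hM using hev
    refine ⟨fun i => max (nf i) (M i), fun i hi j' hj' hij n hn1 hn2 => ?_⟩
    beta_reduce
    rw [if_pos (hM i (lt_trans hi hj) n (le_of_max_le_right hn1)),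
      if_pos (hM j' (lt_trans hj' hj) n (le_of_max_le_right hn2))]
    exact hnf i hi j' hj' hij _ ((le_of_max_le_left hn1).trans (hNk n))
      ((le_of_max_le_left hn2).trans (hNk n))
  · intro u hu
    obtain ⟨m0, hm0⟩ := hg 0 h.regS.ord_pos
    obtain ⟨ξ, hξ, m, hm⟩ := he (Function.extend N u 0) ⟨m0, fun n hn => by
      by_cases hx : ∃ k, N k = n
      · obtain ⟨k, rfl⟩ := hx
        rw [hNm.injective.extend_apply]; exact hu k
      · rw [Function.extend_apply' _ _ _ hx]
        exact (zero_le).trans_lt (hm0 n hn)⟩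
    obtain ⟨m2, hm2⟩ := hev ξ hξ
    refine ⟨ξ, hξ, max m m2, fun k hk => ?_⟩
    beta_reduce
    rw [if_pos (hm2 k (by omega))]
    have := hm (N k) ((show m ≤ k by omega).trans (hNk k))
    rwa [hNm.injective.extend_apply] at this

end M3

section M4
/-- least strict upper bound -/
noncomputable def ssup (a : Set Ordinal.{0}) : Ordinal.{0} := sInf {j | ∀ x ∈ a, x < j}

theorem ssup_le {a : Set Ordinal.{0}} {j : Ordinal.{0}} (h : ∀ x ∈ a, x < j) : ssup a ≤ j :=
  csInf_le (OrderBot.bddBelow _) h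

theorem lt_ssup {a : Set Ordinal.{0}} {j : Ordinal.{0}} (h : ∀ x ∈ a, x < j) {x : Ordinal.{0}}
    (hx : x ∈ a) : x < ssup a :=
  csInf_mem (s := {j | ∀ x ∈ a, x < j}) ⟨j, h⟩ x hx

theorem exists_of_lt_ssup {a : Set Ordinal.{0}} {γ : Ordinal.{0}} (h : γ < ssup a) :
    ∃ x ∈ a, γ ≤ x := by
  by_contra hc
  push Not at hc
  exact absurd (ssup_le hc) (not_le.2 h)

/-- the set R(a) -/
def RR (G : ℕ → Ordinal.{0}) (f : Ordinal.{0} → ℕ → Ordinal.{0}) (a : Set Ordinal.{0}) : Set ℕ :=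
  {m | ∃ x ∈ a, f (ssup a) m ≤ x ∧ x < G m}

/-- equal mod finite -/
def EqF (R K : Set ℕ) : Prop := ∃ m, ∀ n ≥ m, n ∈ R ↔ n ∈ K

theorem EqF.symm {R K : Set ℕ} (h : EqF R K) : EqF K R := by
  obtain ⟨m, hm⟩ := h; exact ⟨m, fun n hn => (hm n hn).symm⟩
theorem EqF.trans {R K M : Set ℕ} (h : EqF R K) (h' : EqF K M) : EqF R M := by
  obtain ⟨m, hm⟩ := h; obtain ⟨m', hm'⟩ := h'
  exact ⟨max m m', fun n hn => (hm n (le_of_max_le_left hn)).trans (hm' n (le_of_max_le_right hn))⟩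

open Classical in
/-- comparison pattern -/
noncomputable def patt (n : ℕ) (y : ℕ → Ordinal.{0}) : Finset (ℕ × ℕ) :=
  (Finset.range n ×ˢ Finset.range n).filter (fun p => y p.1 < y p.2)

/-- code of pattern -/
noncomputable def code (n : ℕ) (y : ℕ → Ordinal.{0}) : ℕ :=
  2 * Nat.pair n (Encodable.encode (patt n y))

/-- code set -/
def Kset (y : ℕ → Ordinal.{0}) : Set ℕ := {l | ∃ n, code n y = l}

theorem le_code (n : ℕ) (y : ℕ → Ordinal.{0}) : n ≤ code n y := by
  have := Nat.left_le_pair n (Encodable.encode (patt n y))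
  unfold code; omega

theorem code_inj {n n' : ℕ} {y y' : ℕ → Ordinal.{0}} (h : code n y = code n' y') :
    n = n' ∧ patt n y = patt n' y' := by
  unfold code at h
  have h1 : Nat.pair n (Encodable.encode (patt n y)) = Nat.pair n' (Encodable.encode (patt n' y')) := by
    omega
  rw [Nat.pair_eq_pair] at h1
  exact ⟨h1.1, Encodable.encode_injective h1.2⟩

theorem code_congr {n : ℕ} {y y' : ℕ → Ordinal.{0}} (h : ∀ k < n, y k = y' k) : code n y = code n y' := by
  have : patt n y = patt n y' := by
    unfold patt
    ext ⟨a, b⟩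
    simp only [Finset.mem_filter, Finset.mem_product, Finset.mem_range]
    constructor
    · rintro ⟨⟨h1, h2⟩, h3⟩
      rw [h a h1, h b h2] at h3
      exact ⟨⟨h1, h2⟩, h3⟩
    · rintro ⟨⟨h1, h2⟩, h3⟩
      rw [← h a h1, ← h b h2] at h3
      exact ⟨⟨h1, h2⟩, h3⟩
  rw [code, code, this]

theorem Kset_patt {y y' : ℕ → Ordinal.{0}} (h : EqF (Kset y) (Kset y')) (k l : ℕ) :
    y k < y l ↔ y' k < y' l := by
  obtain ⟨m, hm⟩ := h
  obtain ⟨n', hn'⟩ := (hm (code (max m (max (k+1) (l+1))) y) ((le_max_left _ _).trans (le_code _ _))).1 ⟨_, rfl⟩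
  obtain ⟨h1, h2⟩ := code_inj hn'
  subst h1
  have := congrArg (fun s => (k, l) ∈ s) h2
  simp only [patt, Finset.mem_filter, Finset.mem_product, Finset.mem_range, eq_iff_iff] at this
  have e1 : k < max m (max (k+1) (l+1)) := by omega
  have e2 : l < max m (max (k+1) (l+1)) := by omega
  simp only [e1, e2, and_self, true_and] at this
  exact this.symm

/-- the family -/
def Afam (μ : Cardinal.{0}) (G : ℕ → Ordinal.{0}) (f : Ordinal.{0} → ℕ → Ordinal.{0}) :
    Set (Set Ordinal.{0}) :=
  {a | a ∈ ctblInf (Iio (Order.succ μ).ord) ∧ ∃ y : ℕ → Ordinal.{0}, range y = a ∧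
    EqF (RR G f a) (Kset y)}

theorem club_closed (A A₀ : Set Ordinal.{0}) (h0 : A₀ ⊆ A) (hc : A₀.Countable)
    (φ : ℕ → Ordinal.{0} → Ordinal.{0}) (hφ : ∀ n, ∀ x ∈ A, φ n x ∈ A) :
    ClubFam A {a | a ∈ small A ∧ A₀ ⊆ a ∧ ∀ n, ∀ x ∈ a, φ n x ∈ a} := by
  refine ⟨fun a ha => ha.1, ?_, ?_⟩
  · intro D hD hne hch hDc
    refine ⟨⟨sUnion_subset fun a ha => (hD ha).1.1, hDc.sUnion fun a ha => (hD ha).1.2⟩, ?_, ?_⟩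
    · obtain ⟨a, ha⟩ := hne
      exact (hD ha).2.1.trans (subset_sUnion_of_mem ha)
    · rintro n x ⟨a, ha, hx⟩
      exact ⟨a, ha, (hD ha).2.2 n x hx⟩
  · intro y hy
    let c : ℕ → Set Ordinal.{0} := fun n => Nat.rec (y ∪ A₀) (fun _ s => s ∪ ⋃ k, φ k '' s) n
    have hc0 : c 0 = y ∪ A₀ := rfl
    have hcs : ∀ n, c (n+1) = c n ∪ ⋃ k, φ k '' (c n) := fun n => rfl
    have hcs' : ∀ n, c n ⊆ A ∧ (c n).Countable := by
      intro n
      induction n with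
      | zero => rw [hc0]; exact ⟨union_subset hy.1 h0, hy.2.union hc⟩
      | succ n ih =>
        rw [hcs]
        refine ⟨union_subset ih.1 (iUnion_subset fun k => ?_), ih.2.union (countable_iUnion fun k => ih.2.image _)⟩
        rintro _ ⟨x, hx, rfl⟩
        exact hφ k x (ih.1 hx)
    refine ⟨⋃ n, c n, ⟨⟨iUnion_subset fun n => (hcs' n).1, countable_iUnion fun n => (hcs' n).2⟩, ?_, ?_⟩, ?_⟩
    · exact (subset_union_right.trans hc0.ge).trans (subset_iUnion c 0)
    · intro n x hx
      obtain ⟨k, hk⟩ := mem_iUnion.1 hx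
      refine mem_iUnion.2 ⟨k+1, ?_⟩
      rw [hcs]
      exact Or.inr (mem_iUnion.2 ⟨n, x, hk, rfl⟩)
    · exact (subset_union_left.trans hc0.ge).trans (subset_iUnion c 0)

theorem H3.cofT {μ G f} (h : H3 μ G f) : (Order.succ μ).ord.cof = Order.succ μ :=
  (Cardinal.isRegular_succ h.big.le).cof_ord
theorem H3.cofTi {μ G f} (h : H3 μ G f) : ℵ₀ < (Order.succ μ).ord.cof := by
  rw [h.cofT]; exact h.big.trans (Order.lt_succ μ)

theorem H3.claim {μ G f} (h : H3 μ G f) (A : Set Ordinal.{0}) (hA : A ⊆ Iio (Order.succ μ).ord)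
    (hAμ : #A ≤ Cardinal.lift.{1,0} μ) :
    ∃ (A₀ : Set Ordinal.{0}) (φ : ℕ → Ordinal.{0} → Ordinal.{0}) (R : Set ℕ), A₀ ⊆ A ∧ A₀.Countable ∧
      (∀ n, ∀ x ∈ A, φ n x ∈ A) ∧
      ∀ a ∈ small A, A₀ ⊆ a → (∀ n, ∀ x ∈ a, φ n x ∈ a) → EqF (RR G f a) R := by
  classical
  obtain ⟨γ, hγ, hγ2⟩ := bdd _ h.cofTi.le A
    (by rw [h.cofT]; exact hAμ.trans_lt (Cardinal.lift_lt.2 (Order.lt_succ μ))) hA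
  have hj : ssup A < (Order.succ μ).ord := (ssup_le hγ2).trans_lt hγ
  have hlt : ∀ x ∈ A, x < ssup A := fun x hx => lt_ssup hγ2 hx
  by_cases hcase : ∃ A₀ ⊆ A, A₀.Countable ∧ ∀ γ < ssup A, ∃ x ∈ A₀, γ ≤ x
  · obtain ⟨A₀, h1, h2, h3⟩ := hcase
    have : ∀ m, ∃ x, m ∈ RR G f A → x ∈ A ∧ f (ssup A) m ≤ x ∧ x < G m := by
      intro m
      by_cases hm : m ∈ RR G f A
      · obtain ⟨x, hx⟩ := hm; exact ⟨x, fun _ => hx⟩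
      · exact ⟨0, fun h => absurd h hm⟩
    choose w hw using this
    refine ⟨A₀ ∪ w '' (RR G f A), fun _ x => x, RR G f A, ?_, ?_, fun _ _ h => h, ?_⟩
    · refine union_subset h1 ?_
      rintro _ ⟨m, hm, rfl⟩
      exact (hw m hm).1
    · exact h2.union ((to_countable _).image _)
    · intro a ha h4 _
      have h5 : ssup a = ssup A := by
        apply le_antisymm (ssup_le fun x hx => hlt x (ha.1 hx))
        by_contra hc
        push Not at hc
        obtain ⟨x, hx, hx2⟩ := h3 _ hc
        exact absurd (lt_ssup (fun x hx => hlt x (ha.1 hx)) (h4 (Or.inl hx))) (not_lt.2 hx2)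
      refine ⟨0, fun m _ => ⟨?_, ?_⟩⟩
      · rintro ⟨x, hx, hx2⟩
        rw [h5] at hx2
        exact ⟨x, ha.1 hx, hx2⟩
      · intro hm
        refine ⟨w m, h4 (Or.inr ⟨m, hm, rfl⟩), ?_⟩
        rw [h5]
        exact (hw m hm).2
  · have hcase' : ∀ A₀ ⊆ A, A₀.Countable → ∃ γ < ssup A, ∀ x ∈ A₀, x < γ := by
      intro A₀ h1 h2
      by_contra hc
      push Not at hc
      exact hcase ⟨A₀, h1, h2, hc⟩
    obtain ⟨nf, hnf⟩ := h.f2 _ hj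
    have hn : ∃ n, ∀ γ < ssup A, ∃ x ∈ A, nf x ≤ n ∧ γ ≤ x := by
      by_contra hc
      push Not at hc
      choose γ hγ hγ2 using hc
      choose x hx hx2 using fun n => exists_of_lt_ssup (hγ n)
      obtain ⟨δ, hδ, hδ2⟩ := hcase' (range x) (by rintro _ ⟨n, rfl⟩; exact hx n) (countable_range x)
      obtain ⟨ζ, hζ, hζ2⟩ := exists_of_lt_ssup hδ
      have a1 := hγ2 (nf ζ) ζ hζ le_rfl
      have a2 := hδ2 _ ⟨nf ζ, rfl⟩
      exact absurd (((a1.trans_le (hx2 _)).trans a2).trans_le hζ2) (lt_irrefl _)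
    obtain ⟨N, hN⟩ := hn
    let R : Set ℕ := {m | ∃ x ∈ A, x < G m ∧ ∀ ζ ∈ A, nf ζ ≤ N → f ζ m ≤ x}
    have hw : ∀ m, ∃ x, m ∈ R → x ∈ A ∧ x < G m ∧ ∀ ζ ∈ A, nf ζ ≤ N → f ζ m ≤ x := by
      intro m
      by_cases hm : m ∈ R
      · obtain ⟨x, hx⟩ := hm; exact ⟨x, fun _ => hx⟩
      · exact ⟨0, fun h => absurd h hm⟩
    choose w hw using hw
    have hz : ∀ m x, ∃ ζ, (x ∈ A → ζ ∈ A) ∧ (m ∉ R → x ∈ A → x < G m → nf ζ ≤ N ∧ x < f ζ m) := by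
      intro m x
      by_cases hm : m ∉ R ∧ x ∈ A ∧ x < G m
      · obtain ⟨h1, h2, h3⟩ := hm
        have h1' : ¬ ∃ x ∈ A, x < G m ∧ ∀ ζ ∈ A, nf ζ ≤ N → f ζ m ≤ x := h1
        push Not at h1'
        obtain ⟨ζ, b1, b2, b3⟩ := h1' x h2 h3
        exact ⟨ζ, fun _ => b1, fun _ _ _ => ⟨b2, b3⟩⟩
      · exact ⟨x, fun h => h, fun a b c => absurd ⟨a, b, c⟩ hm⟩
    choose z hz1 hz2 using hz
    refine ⟨w '' R, z, R, ?_, (to_countable _).image _, hz1, ?_⟩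
    · rintro _ ⟨m, hm, rfl⟩; exact (hw m hm).1
    · intro a ha h4 h5
      obtain ⟨δ, hδ, hδ2⟩ := hcase' a ha.1 ha.2
      have hi : ssup a < ssup A := (ssup_le hδ2).trans_lt hδ
      refine ⟨max N (nf (ssup a)), fun m hm => ⟨?_, ?_⟩⟩
      · rintro ⟨x, hx, hx2, hx3⟩
        by_contra hmR
        obtain ⟨b1, b2⟩ := hz2 m x hmR (ha.1 hx) hx3
        have b3 : z m x < ssup a := lt_ssup hδ2 (h5 m x hx)
        have := hnf _ (hlt _ (hz1 m x (ha.1 hx))) _ hi b3 m (b1.trans (le_of_max_le_left hm))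
          (le_of_max_le_right hm)
        exact absurd (b2.trans this) (not_lt.2 hx2)
      · intro hmR
        obtain ⟨b1, b2, b3⟩ := hw m hmR
        refine ⟨w m, h4 ⟨m, hmR, rfl⟩, ?_, b2⟩
        obtain ⟨ζ, c1, c2, c3⟩ := hN _ hi
        rcases c3.eq_or_lt with c3 | c3
        · rw [c3]; exact b3 ζ c1 c2
        · exact (hnf _ hi _ (hlt _ c1) c3 m (le_of_max_le_right hm) (c2.trans (le_of_max_le_left hm))).le.trans
            (b3 ζ c1 c2)

theorem exists_seg (A a : Set Ordinal.{0}) (hA : ¬ A.Countable) (ha : a.Countable) :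
    ∃ (t : A) (p : a → A), StrictMono p ∧ (∀ x, p x < t) ∧ ∀ b < t, ∃ x, p x = b := by
  have : Ordinal.type ((· < ·) : a → a → Prop) < Ordinal.type ((· < ·) : A → A → Prop) := by
    by_contra hc
    push Not at hc
    have := Ordinal.card_le_card hc
    rw [Ordinal.card_type, Ordinal.card_type] at this
    apply hA
    rw [← Cardinal.le_aleph0_iff_set_countable] at ha ⊢
    exact this.trans ha
  rw [Ordinal.type_lt_iff] at this
  obtain ⟨p⟩ := this
  refine ⟨p.top, p, fun x y hxy => p.map_rel_iff.2 hxy, fun x => p.lt_top x, fun b hb => ?_⟩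
  exact (p.mem_range_iff_rel).2 hb

theorem H3.nonrefl {μ G f} (h : H3 μ G f) (A : Set Ordinal.{0}) (hA : A ⊆ Iio (Order.succ μ).ord)
    (hAc : ¬ A.Countable)
    (hAμ : #A ≤ Cardinal.lift.{1,0} μ) : ¬ Reflects (Afam μ G f) A := by
  rintro ⟨_, hmeet⟩
  obtain ⟨A₀, φ, R, h1, h2, h3, h4⟩ := h.claim A hA hAμ
  obtain ⟨a₁, ⟨⟨_, y₁, hy₁, hR₁⟩, ha₁⟩, c1, c2, c3⟩ := hmeet _ (club_closed A A₀ h1 h2 φ h3)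
  obtain ⟨t, p, hp1, hp2, hp3⟩ := exists_seg A a₁ hAc ha₁.2.1
  have hB : ({x | x ∈ A ∧ x ≤ t.1}).Countable := by
    have := ha₁.2.1.to_subtype
    refine ((countable_range (fun x => (p x).1)).insert t.1).mono ?_
    rintro x ⟨hx, hxt⟩
    rcases hxt.eq_or_lt with e | e
    · exact Or.inl e
    · obtain ⟨z, hz⟩ := hp3 ⟨x, hx⟩ e
      exact Or.inr ⟨z, by simp [hz]⟩
  obtain ⟨a₂, ⟨⟨_, y₂, hy₂, hR₂⟩, ha₂⟩, d1, d2, d3⟩ := hmeet _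
    (club_closed A (A₀ ∪ {x | x ∈ A ∧ x ≤ t.1}) (union_subset h1 fun x hx => hx.1) (h2.union hB) φ h3)
  have e1 := h4 a₁ c1 c2 c3
  have e2 := h4 a₂ d1 (subset_union_left.trans d2) d3
  have e3 : EqF (Kset y₂) (Kset y₁) := (hR₂.symm.trans e2).trans (e1.symm.trans hR₁)
  have e4 := Kset_patt e3
  have hk : ∀ x : {x | x ∈ A ∧ x ≤ t.1}, ∃ k, y₂ k = x.1 := by
    intro x
    have : x.1 ∈ range y₂ := by rw [hy₂]; exact d2 (Or.inr x.2)
    exact this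
  choose k hk using hk
  let e : {x | x ∈ A ∧ x ≤ t.1} → {x | x ∈ A ∧ x ≤ t.1} := fun x =>
    ⟨(p ⟨y₁ (k x), hy₁ ▸ mem_range_self _⟩).1, (p _).2, (hp2 _).le⟩
  have he : StrictMono e := by
    intro x x' hx
    have : y₁ (k x) < y₁ (k x') := by
      rw [← e4, hk, hk]; exact hx
    exact hp1 (a := ⟨y₁ (k x), hy₁ ▸ mem_range_self _⟩) (b := ⟨y₁ (k x'), hy₁ ▸ mem_range_self _⟩) this
  have := he.le_apply (x := ⟨t.1, t.2, le_rfl⟩)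
  exact absurd (hp2 ⟨y₁ (k ⟨t.1, t.2, le_rfl⟩), hy₁ ▸ mem_range_self _⟩) (not_lt.2 this)

end M4

section M5
/-- nodes are reversed lists -/
abbrev Nd := List Ordinal.{0}

theorem exists_en (θ : Ordinal.{0}) (h0 : 0 < θ) (𝒞 : Set (Set Ordinal.{0})) (hC : ClubFam (Iio θ) 𝒞) :
    ∃ en : Nd → ℕ → Ordinal.{0}, (∀ q, range (en q) ∈ 𝒞) ∧ (∀ s q, range (en q) ⊆ range (en (s :: q))) ∧
      ∀ s q, s < θ → s ∈ range (en (s :: q)) := by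
  classical
  have h1 : ∀ y, ∃ x, y ∈ small (Iio θ) → x ∈ 𝒞 ∧ y ⊆ x := by
    intro y
    by_cases hy : y ∈ small (Iio θ)
    · obtain ⟨x, hx⟩ := hC.2.2 y hy
      exact ⟨x, fun _ => hx⟩
    · exact ⟨∅, fun h => absurd h hy⟩
  choose c hc using h1
  let Cl : Nd → Set Ordinal.{0} := fun q => List.rec (c {0}) (fun s _ A => if s < θ then c (insert s A) else A) q
  have e0 : Cl [] = c {0} := rfl
  have e1 : ∀ s q, Cl (s :: q) = if s < θ then c (insert s (Cl q)) else Cl q := fun s q => rfl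
  have hz : ({0} : Set Ordinal.{0}) ∈ small (Iio θ) := ⟨by simpa using h0, countable_singleton 0⟩
  have hins : ∀ s A, s < θ → A ∈ 𝒞 → insert s A ∈ small (Iio θ) := fun s A hs hA =>
    ⟨insert_subset hs (hC.1 hA).1, (hC.1 hA).2.insert s⟩
  have h2 : ∀ q, Cl q ∈ 𝒞 := by
    intro q
    induction q with
    | nil => rw [e0]; exact (hc _ hz).1
    | cons s q ih =>
      rw [e1]; split_ifs with hs
      · exact (hc _ (hins s _ hs ih)).1
      · exact ih
  have h3 : ∀ s q, Cl q ⊆ Cl (s :: q) := by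
    intro s q
    rw [e1]; split_ifs with hs
    · exact (subset_insert _ _).trans (hc _ (hins s _ hs (h2 q))).2
    · exact subset_rfl
  have h4 : ∀ q, (Cl q).Nonempty := by
    intro q
    induction q with
    | nil => rw [e0]; exact ⟨0, (hc _ hz).2 rfl⟩
    | cons s q ih => exact ih.mono (h3 s q)
  choose en hen using fun q => (hC.1 (h2 q)).2.exists_eq_range (h4 q)
  refine ⟨en, fun q => ?_, fun s q => ?_, fun s q hs => ?_⟩
  · rw [← hen]; exact h2 q
  · rw [← hen, ← hen]; exact h3 s q
  · rw [← hen, e1, if_pos hs]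
    exact (hc _ (hins s _ hs (h2 q))).2 (mem_insert _ _)

/-- game hypotheses -/
structure HG (θ : Ordinal.{0}) (G : ℕ → Ordinal.{0}) : Prop where
  G1 : ∀ k, ℵ₀ < (G k).cof
  G2 : ∀ k l, k < l → (G k).card < (G l).cof
  Gt : ∀ k, (G k).card < θ.cof
  tc : ℵ₀ < θ.cof

/-- y-value read off from node -/
def yv (en : Nd → ℕ → Ordinal.{0}) (q : Nd) (k : ℕ) : Ordinal.{0} :=
  en (q.drop (q.length - (Nat.unpair k).1)) (Nat.unpair k).2

/-- Q predicate -/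
def QQ (en : Nd → ℕ → Ordinal.{0}) (q : Nd) : Prop := ∃ n, code n (yv en q) = q.length

open Classical in
/-- domain of move -/
noncomputable def dom (θ : Ordinal.{0}) (G : ℕ → Ordinal.{0}) (en : Nd → ℕ → Ordinal.{0}) (q : Nd) : Ordinal.{0} :=
  if QQ en q then G q.length else θ

/-- forcing -/
def Force (θ : Ordinal.{0}) (G : ℕ → Ordinal.{0}) (en : Nd → ℕ → Ordinal.{0}) (X : Set Nd) (q : Nd) : Prop :=
  ∃ h : Nd → Ordinal.{0}, (∀ r, h r < dom θ G en r) ∧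
    ∀ t : ℕ → Nd, t 0 = q → (∀ k, ∃ s, h (t k) ≤ s ∧ s < dom θ G en (t k) ∧ t (k + 1) = s :: t k) →
      ∃ k, t k ∈ X

/-- nodes with large elements -/
def Xset (G : ℕ → Ordinal.{0}) (en : Nd → ℕ → Ordinal.{0}) (q : Nd) (γ : Ordinal.{0}) : Set Nd :=
  {r | ∃ x ∈ range (en r), x < G q.length ∧ γ ≤ x}

variable {θ : Ordinal.{0}} {G : ℕ → Ordinal.{0}} {en : Nd → ℕ → Ordinal.{0}}

theorem pos_of_cof {o : Ordinal.{0}} (h : ℵ₀ < o.cof) : 0 < o := by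
  rw [pos_iff_ne_zero]
  intro h0
  rw [h0] at h
  simp at h

theorem HG.dom_pos (h : HG θ G) (q : Nd) : 0 < dom θ G en q := by
  unfold dom; split_ifs
  · exact pos_of_cof (h.G1 _)
  · exact pos_of_cof h.tc

theorem getD_suffix {s : Ordinal.{0}} {q r : Nd} (h : s :: q <:+ r) :
    r.getD (r.length - q.length - 1) 0 = s := by
  obtain ⟨w, rfl⟩ := h
  have : (w ++ s :: q).length - q.length - 1 = w.length := by simp; omega
  rw [this, List.getD_append_right _ _ _ _ le_rfl]
  simp

theorem HG.lemA (h : HG θ G) {X : Set Nd} {q : Nd} (hF : ¬ Force θ G en X q) :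
    q ∉ X ∧ ∀ η < dom θ G en q, ∃ s, η ≤ s ∧ s < dom θ G en q ∧ ¬ Force θ G en X (s :: q) := by
  classical
  constructor
  · intro hq
    exact hF ⟨fun _ => 0, fun r => h.dom_pos r, fun t ht _ => ⟨0, by rw [ht]; exact hq⟩⟩
  · intro η hη
    by_contra hcon
    push Not at hcon
    apply hF
    have h1 : ∀ s, ∃ hs : Nd → Ordinal.{0}, (∀ r, hs r < dom θ G en r) ∧ (η ≤ s → s < dom θ G en q →
      ∀ t : ℕ → Nd, t 0 = s :: q → (∀ k, ∃ s, hs (t k) ≤ s ∧ s < dom θ G en (t k) ∧ t (k + 1) = s :: t k) →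
      ∃ k, t k ∈ X) := by
      intro s
      by_cases hs : η ≤ s ∧ s < dom θ G en q
      · obtain ⟨hs', h1, h2⟩ := hcon s hs.1 hs.2
        exact ⟨hs', h1, fun _ _ => h2⟩
      · exact ⟨fun _ => 0, fun r => h.dom_pos r, fun a b => absurd ⟨a, b⟩ hs⟩
    choose hs hs1 hs2 using h1
    refine ⟨fun r => if r = q then η else hs (r.getD (r.length - q.length - 1) 0) r, ?_, ?_⟩
    · intro r
      beta_reduce
      split_ifs with hr
      · rw [hr]; exact hη
      · exact hs1 _ r
    · intro t ht ht2
      obtain ⟨s, a1, a2, a3⟩ := ht2 0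
      beta_reduce at a1
      rw [if_pos ht] at a1
      rw [ht] at a2 a3
      have hsuf : ∀ k, s :: q <:+ t (k + 1) := by
        intro k
        induction k with
        | zero => rw [a3]
        | succ k ih =>
          obtain ⟨s', _, _, b3⟩ := ht2 (k + 1)
          rw [b3]
          exact ih.trans (List.suffix_cons _ _)
      obtain ⟨k, hk⟩ := hs2 s a1 a2 (fun k => t (k + 1)) a3 (by
        intro k
        obtain ⟨s', b1, b2, b3⟩ := ht2 (k + 1)
        have hne : t (k + 1) ≠ q := by
          intro e
          have := (hsuf k).length_le
          rw [e] at this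
          simp at this
        beta_reduce at b1
        rw [if_neg hne, getD_suffix (hsuf k)] at b1
        exact ⟨s', b1, b2, b3⟩)
      exact ⟨k + 1, hk⟩

theorem HG.lemB (h : HG θ G) {X : Set Nd} {p : Nd} (hF : ¬ Force θ G en X p) (hQ : ¬ QQ en p) :
    ∃ γ < G p.length, ¬ Force θ G en (X ∪ Xset G en p γ) p := by
  classical
  by_contra hcon
  push Not at hcon
  have h1 : ∀ γ, ∃ hs : Nd → Ordinal.{0}, (∀ r, hs r < dom θ G en r) ∧ (γ < G p.length →
      ∀ t : ℕ → Nd, t 0 = p → (∀ k, ∃ s, hs (t k) ≤ s ∧ s < dom θ G en (t k) ∧ t (k + 1) = s :: t k) →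
      ∃ k, t k ∈ (X ∪ Xset G en p γ)) := by
    intro γ
    by_cases hs : γ < G p.length
    · obtain ⟨hs', h1, h2⟩ := hcon γ hs
      exact ⟨hs', h1, fun _ => h2⟩
    · exact ⟨fun _ => 0, fun r => h.dom_pos r, fun a => absurd a hs⟩
  choose hs hs1 hs2 using h1
  have h2 : ∀ r, p <:+ r → ¬ Force θ G en X r → ∃ s, (∀ γ < G p.length, hs γ r ≤ s) ∧ s < dom θ G en r ∧
      ¬ Force θ G en X (s :: r) := by
    intro r hpr hr
    have hcof : (G p.length).card < (dom θ G en r).cof ∧ ℵ₀ ≤ (dom θ G en r).cof := by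
      unfold dom
      split_ifs with hq
      · refine ⟨h.G2 _ _ ?_, (h.G1 _).le⟩
        rcases hpr.length_le.eq_or_lt with e | e
        · exact absurd (hpr.eq_of_length e ▸ hq) hQ
        · exact e
      · exact ⟨h.Gt _, h.tc.le⟩
    obtain ⟨η, hη, hη2⟩ := bddi (dom θ G en r) hcof.2 (Iio (G p.length)) (fun γ => hs γ r)
      (by rw [mk_Iio']; exact Cardinal.lift_lt.2 hcof.1) (fun γ _ => hs1 γ r)
    obtain ⟨s, b1, b2, b3⟩ := (h.lemA hr).2 η hη
    exact ⟨s, fun γ hγ => (hη2 γ hγ).le.trans b1, b2, b3⟩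
  choose! nx hnx using h2
  let t : ℕ → Nd := fun k => Nat.rec p (fun _ r => nx r :: r) k
  have ht : ∀ k, t (k + 1) = nx (t k) :: t k := fun k => rfl
  have hinv : ∀ k, p <:+ t k ∧ ¬ Force θ G en X (t k) := by
    intro k
    induction k with
    | zero => exact ⟨List.suffix_rfl, hF⟩
    | succ k ih =>
      rw [ht]
      exact ⟨ih.1.trans (List.suffix_cons _ _), (hnx _ ih.1 ih.2).2.2⟩
  obtain ⟨γ, hγ, hγ2⟩ := bddC (G p.length) (h.G1 _) ((⋃ k, range (en (t k))) ∩ Iio (G p.length))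
    ((countable_iUnion fun k => countable_range _).mono inter_subset_left) (fun x hx => hx.2)
  obtain ⟨k, hk⟩ := hs2 γ hγ t rfl (fun k => ⟨nx (t k), (hnx _ (hinv k).1 (hinv k).2).1 γ hγ,
    (hnx _ (hinv k).1 (hinv k).2).2.1, rfl⟩)
  rcases hk with hk | ⟨x, hx, hx2, hx3⟩
  · exact (h.lemA (hinv k).2).1 hk
  · exact absurd (hγ2 x ⟨mem_iUnion.2 ⟨k, hx⟩, hx2⟩) (not_lt.2 hx3)

open Classical in
/-- choice of bound -/
noncomputable def gam (θ : Ordinal.{0}) (G : ℕ → Ordinal.{0}) (en : Nd → ℕ → Ordinal.{0}) (X : Set Nd)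
    (q : Nd) : Ordinal.{0} :=
  if h : ∃ γ < G q.length, ¬ Force θ G en (X ∪ Xset G en q γ) q then h.choose else 0

open Classical in
/-- forbidden sets -/
noncomputable def XX (θ : Ordinal.{0}) (G : ℕ → Ordinal.{0}) (en : Nd → ℕ → Ordinal.{0}) : Nd → Set Nd
  | [] => ∅
  | _ :: q => XX θ G en q ∪ (if QQ en q then ∅ else Xset G en q (gam θ G en (XX θ G en q) q))

/-- gamma of node -/
noncomputable def gm (θ : Ordinal.{0}) (G : ℕ → Ordinal.{0}) (en : Nd → ℕ → Ordinal.{0}) (q : Nd) : Ordinal.{0} :=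
  gam θ G en (XX θ G en q) q

/-- valid nodes -/
def Valid (θ : Ordinal.{0}) (G : ℕ → Ordinal.{0}) (en : Nd → ℕ → Ordinal.{0}) (q : Nd) : Prop :=
  ¬ Force θ G en (XX θ G en q) q

theorem HG.gm_lt (h : HG θ G) (q : Nd) : gm θ G en q < G q.length := by
  unfold gm gam
  split_ifs with hx
  · exact hx.choose_spec.1
  · exact pos_of_cof (h.G1 _)

theorem HG.valid_nil (_h : HG θ G) : Valid θ G en [] := by
  rintro ⟨h, h1, h2⟩
  let t : ℕ → Nd := fun k => Nat.rec [] (fun _ r => h r :: r) k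
  obtain ⟨k, hk⟩ := h2 t rfl (fun k => ⟨h (t k), le_rfl, h1 _, rfl⟩)
  exact hk

theorem HG.valid_step (h : HG θ G) {q : Nd} (hq : Valid θ G en q) {η : Ordinal.{0}} (hη : η < dom θ G en q) :
    ∃ s, η ≤ s ∧ s < dom θ G en q ∧ Valid θ G en (s :: q) := by
  have h1 : ¬ Force θ G en (XX θ G en (0 :: q)) q := by
    rw [XX]
    by_cases hQ : QQ en q
    · rw [if_pos hQ, union_empty]; exact hq
    · rw [if_neg hQ]
      have h2 := h.lemB hq hQ
      unfold gam
      rw [dif_pos h2]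
      exact h2.choose_spec.2
  obtain ⟨s, a1, a2, a3⟩ := (h.lemA h1).2 η hη
  exact ⟨s, a1, a2, a3⟩

theorem XX_mono {q r : Nd} (h : q <:+ r) : XX θ G en q ⊆ XX θ G en r := by
  obtain ⟨w, rfl⟩ := h
  induction w with
  | nil => exact subset_rfl
  | cons s w ih => exact ih.trans subset_union_left

theorem HG.valid_bound (h : HG θ G) {q r : Nd} {s : Ordinal.{0}} (hr : Valid θ G en r) (hs : s :: q <:+ r)
    (hQ : ¬ QQ en q) {x : Ordinal.{0}} (hx : x ∈ range (en r)) (hxG : x < G q.length) : x < gm θ G en q := by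
  by_contra hc
  push Not at hc
  refine (h.lemA hr).1 (XX_mono hs ?_)
  right
  rw [if_neg hQ]
  exact ⟨x, hx, hxG, hc⟩

open Classical in
/-- next move -/
noncomputable def nxt (θ : Ordinal.{0}) (G : ℕ → Ordinal.{0}) (en : Nd → ℕ → Ordinal.{0}) (q : Nd)
    (η : Ordinal.{0}) : Ordinal.{0} :=
  if h : ∃ s, η ≤ s ∧ s < dom θ G en q ∧ Valid θ G en (s :: q) then h.choose else 0

theorem HG.nxt_spec (h : HG θ G) {q : Nd} (hq : Valid θ G en q) {η : Ordinal.{0}} (hη : η < dom θ G en q) :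
    η ≤ nxt θ G en q η ∧ nxt θ G en q η < dom θ G en q ∧ Valid θ G en (nxt θ G en q η :: q) := by
  have := h.valid_step hq hη
  unfold nxt
  rw [dif_pos this]
  exact this.choose_spec

theorem HG.nxt_dom (h : HG θ G) (q : Nd) (η : Ordinal.{0}) : nxt θ G en q η < dom θ G en q := by
  unfold nxt
  split_ifs with hx
  · exact hx.choose_spec.2.1
  · exact h.dom_pos q

/-- e-consistent nodes -/
def Con (θ : Ordinal.{0}) (G : ℕ → Ordinal.{0}) (en : Nd → ℕ → Ordinal.{0}) (e : ℕ → Ordinal.{0}) : Nd → Prop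
  | [] => True
  | s :: q => Con θ G en e q ∧ ((QQ en q ∧ s < G q.length) ∨ (¬ QQ en q ∧ s = nxt θ G en q (e q.length)))

/-- set of consistent nodes -/
def NN (θ : Ordinal.{0}) (G : ℕ → Ordinal.{0}) (en : Nd → ℕ → Ordinal.{0}) (e : ℕ → Ordinal.{0}) (k : ℕ) : Set Nd :=
  {r | r.length = k ∧ Con θ G en e r}

theorem NN_succ (e : ℕ → Ordinal.{0}) (k : ℕ) : NN θ G en e (k + 1) ⊆
    (fun p : Nd × Ordinal.{0} => p.2 :: p.1) '' (NN θ G en e k ×ˢ Iio (G k)) ∪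
    (fun r : Nd => nxt θ G en r (e k) :: r) '' (NN θ G en e k) := by
  rintro (_ | ⟨s, q⟩) ⟨h1, h2⟩
  · simp at h1
  · have hl : q.length = k := by simpa using h1
    obtain ⟨h3, h4 | h4⟩ := h2
    · left; exact ⟨(q, s), ⟨⟨hl, h3⟩, by rw [← hl]; exact h4.2⟩, rfl⟩
    · right
      refine ⟨q, ⟨hl, h3⟩, ?_⟩
      beta_reduce
      rw [h4.2, hl]

theorem Con_congr {e e' : ℕ → Ordinal.{0}} (r : Nd) (h : ∀ n < r.length, e n = e' n) :
    Con θ G en e r ↔ Con θ G en e' r := by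
  induction r with
  | nil => rfl
  | cons s q ih =>
    unfold Con
    rw [ih (fun n hn => h n (hn.trans (by simp))), h q.length (by simp)]

theorem NN_congr {e e' : ℕ → Ordinal.{0}} {k : ℕ} (h : ∀ n < k, e n = e' n) :
    NN θ G en e k = NN θ G en e' k := by
  ext r
  constructor
  · rintro ⟨h1, h2⟩
    exact ⟨h1, (Con_congr r (by rw [h1]; exact h)).1 h2⟩
  · rintro ⟨h1, h2⟩
    exact ⟨h1, (Con_congr r (by rw [h1]; exact h)).2 h2⟩

theorem HG.card_NN (h : HG θ G) (e : ℕ → Ordinal.{0}) (k : ℕ) :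
    #(NN θ G en e k) < Cardinal.lift.{1,0} (G k).cof := by
  induction k with
  | zero =>
    have : #(NN θ G en e 0) ≤ 1 := by
      rw [Cardinal.le_one_iff_subsingleton]
      refine ⟨fun a b => Subtype.ext ?_⟩
      rw [List.length_eq_zero_iff.1 a.2.1, List.length_eq_zero_iff.1 b.2.1]
    exact this.trans_lt (Cardinal.one_lt_aleph0.trans (Cardinal.aleph0_lt_lift.2 (h.G1 0)))
  | succ k ih =>
    have hc : #(NN θ G en e k) ≤ Cardinal.lift.{1,0} (G k).card :=
      ih.le.trans (Cardinal.lift_le.2 (Ordinal.cof_le_card _))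
    have hi : ℵ₀ ≤ Cardinal.lift.{1,0} (G k).card :=
      Cardinal.aleph0_le_lift.2 ((h.G1 k).le.trans (Ordinal.cof_le_card _))
    refine lt_of_le_of_lt ?_ (Cardinal.lift_lt.2 (h.G2 k (k+1) (Nat.lt_succ_self k)))
    refine (Cardinal.mk_le_mk_of_subset (NN_succ e k)).trans ?_
    refine (Cardinal.mk_union_le _ _).trans ?_
    refine Cardinal.add_le_of_le hi ?_ ?_
    · refine Cardinal.mk_image_le.trans ?_
      rw [Cardinal.mk_setProd, mk_Iio']
      exact Cardinal.mul_le_of_le hi hc le_rfl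
    · exact Cardinal.mk_image_le.trans hc

open Classical in
/-- bound for gm on a set of nodes -/
noncomputable def GB (θ : Ordinal.{0}) (G : ℕ → Ordinal.{0}) (en : Nd → ℕ → Ordinal.{0}) (S : Set Nd) (k : ℕ) :
    Ordinal.{0} :=
  if h : ∃ γ < G k, ∀ r ∈ S, gm θ G en r < γ then h.choose else 0

/-- Gamma_e -/
noncomputable def GE (θ : Ordinal.{0}) (G : ℕ → Ordinal.{0}) (en : Nd → ℕ → Ordinal.{0}) (e : ℕ → Ordinal.{0})
    (k : ℕ) : Ordinal.{0} := GB θ G en (NN θ G en e k) k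

theorem HG.GE_spec (h : HG θ G) (e : ℕ → Ordinal.{0}) (k : ℕ) :
    GE θ G en e k < G k ∧ ∀ r ∈ NN θ G en e k, gm θ G en r < GE θ G en e k := by
  have : ∃ γ < G k, ∀ r ∈ NN θ G en e k, gm θ G en r < γ :=
    bddi (G k) (h.G1 k).le _ _ (h.card_NN e k) (fun r hr => by
      have := h.gm_lt (en := en) r
      rwa [hr.1] at this)
  unfold GE GB
  rw [dif_pos this]
  exact this.choose_spec

theorem GE_congr {e e' : ℕ → Ordinal.{0}} {k : ℕ} (h : ∀ n < k, e n = e' n) :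
    GE θ G en e k = GE θ G en e' k := by
  unfold GE; rw [NN_congr h]

end M5

section M6
theorem H3.toHG {μ G f} (h : H3 μ G f) : HG (Order.succ μ).ord G := by
  refine ⟨h.G1, ?_, ?_, h.cofTi⟩
  · intro k l hkl
    induction l, hkl using Nat.le_induction with
    | base => exact h.G2 k
    | succ l _ ih => exact (ih.trans_le (Ordinal.cof_le_card _)).trans (h.G2 l)
  · intro k
    rw [h.cofT]
    exact Cardinal.lt_ord.1 (h.G3 k)

/-- decode finitely supported function -/
noncomputable def dec : List (ℕ × Ordinal.{0}) → ℕ → Ordinal.{0}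
  | [] => fun _ => 0
  | p :: l => Function.update (dec l) p.1 p.2

theorem H3.clo {μ G f} (h : H3 μ G f) (u : List (ℕ × Ordinal.{0}) → Ordinal.{0})
    (hu : ∀ l, (∀ p ∈ l, p.2 < (Order.succ μ).ord) → u l < (Order.succ μ).ord) (B : Ordinal.{0})
    (hB : B < (Order.succ μ).ord) :
    ∃ I : ℕ → Ordinal.{0}, StrictMono I ∧ (∀ j, I j < (Order.succ μ).ord) ∧ B ≤ I 0 ∧
      ∀ j l, (∀ p ∈ l, p.2 < I j) → u l < I (j + 1) := by
  set θ := (Order.succ μ).ord with hθ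
  have h1 : ∀ x, x < θ → ∃ x', x' < θ ∧ x < x' ∧ ∀ l, (∀ p ∈ l, p.2 < x) → u l < x' := by
    intro x hx
    have hT : #{l : List (ℕ × Ordinal.{0}) | ∀ p ∈ l, p.2 < x} ≤ Cardinal.lift.{1,0} μ := by
      have hsub : {l : List (ℕ × Ordinal.{0}) | ∀ p ∈ l, p.2 < x} ⊆
          range (fun l : List (ℕ × Iio x) => l.map (fun p => (p.1, p.2.1))) := by
        intro l hl
        induction l with
        | nil => exact ⟨[], rfl⟩
        | cons p l ih =>
          obtain ⟨l', hl'⟩ := ih (fun q hq => hl q (List.mem_cons_of_mem _ hq))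
          refine ⟨(p.1, ⟨p.2, hl p List.mem_cons_self⟩) :: l', ?_⟩
          beta_reduce at hl' ⊢
          rw [List.map_cons, hl']
      have hi : ℵ₀ ≤ Cardinal.lift.{1,0} μ := Cardinal.aleph0_le_lift.2 h.big.le
      refine (Cardinal.mk_le_mk_of_subset hsub).trans (Cardinal.mk_range_le.trans ?_)
      refine (Cardinal.mk_list_le_max _).trans (max_le hi ?_)
      rw [Cardinal.mk_prod]
      refine Cardinal.mul_le_of_le hi ?_ ?_
      · simpa using hi
      · rw [mk_Iio', Cardinal.lift_uzero]
        exact Cardinal.lift_le.2 (Order.lt_succ_iff.1 (Cardinal.lt_ord.1 hx))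
    obtain ⟨γ, hγ, hγ2⟩ := bddi θ h.cofTi.le {l : List (ℕ × Ordinal.{0}) | ∀ p ∈ l, p.2 < x} u
      (by rw [h.cofT]; exact hT.trans_lt (Cardinal.lift_lt.2 (Order.lt_succ μ)))
      (fun l hl => hu l (fun p hp => (hl p hp).trans hx))
    refine ⟨max γ (Order.succ x), max_lt hγ ?_, (Order.lt_succ x).trans_le (le_max_right _ _),
      fun l hl => (hγ2 l hl).trans_le (le_max_left _ _)⟩
    exact (Cardinal.isSuccLimit_ord (h.big.le.trans (Order.le_succ μ))).succ_lt hx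
  choose! nx n1 n2 n3 using h1
  let I : ℕ → Ordinal.{0} := fun j => Nat.rec B (fun _ x => nx x) j
  have hI : ∀ j, I j < θ := by
    intro j
    induction j with
    | zero => exact hB
    | succ j ih => exact n1 _ ih
  refine ⟨I, strictMono_nat_of_lt_succ fun j => n2 _ (hI j), hI, le_rfl, fun j l hl => n3 _ (hI j) l hl⟩

theorem H3.star {μ G f} (h : H3 μ G f) (en : Nd → ℕ → Ordinal.{0}) (e : ℕ → Ordinal.{0}) (η : Ordinal.{0}) :
    ∃ i < (Order.succ μ).ord, ∃ M, ∀ k ≥ M, ∀ n,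
      GE (Order.succ μ).ord G en (Function.update e n η) k < f i k := by
  have h1 : ∀ k, ∃ γ < G k, ∀ n, GE (Order.succ μ).ord G en (Function.update e n η) k < γ :=
    fun k => bddN (G k) (h.G1 k) _ (fun n => (h.toHG.GE_spec _ k).1)
  choose γ h1 h2 using h1
  obtain ⟨i, hi, M, hM⟩ := h.f3 γ h1
  exact ⟨i, hi, M, fun k hk n => (h2 k n).trans (hM k hk)⟩

/-- the outcome of the closure argument -/
theorem H3.lemC {μ G f} (h : H3 μ G f) (en : Nd → ℕ → Ordinal.{0})
    (hen : ∀ q, ∃ δ < (Order.succ μ).ord, ∀ x ∈ range (en q), x < δ) :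
    ∃ i < (Order.succ μ).ord, ∃ I : ℕ → Ordinal.{0}, StrictMono I ∧ (∀ j, I j < i) ∧
      (∀ x < i, ∃ j, x < I j) ∧ (∀ k, G k ≤ i) ∧
      (∀ q : Nd, (∀ x ∈ q, x < i) → ∀ η < i, nxt (Order.succ μ).ord G en q η < i) ∧
      (∀ q : Nd, (∀ x ∈ q, x < i) → ∀ x ∈ range (en q), x < i) ∧
      (∀ l : List (ℕ × Ordinal.{0}), (∀ p ∈ l, p.2 < i) → ∀ η < i, ∃ M, ∀ k ≥ M, ∀ n,
        GE (Order.succ μ).ord G en (Function.update (dec l) n η) k < f i k) := by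
  set θ := (Order.succ μ).ord with hθ
  have h0 : 0 < θ := pos_of_cof h.cofTi
  choose st st1 st2 using fun l : List (ℕ × Ordinal.{0}) => h.star en (dec l)
  choose dl dl1 dl2 using hen
  let u : List (ℕ × Ordinal.{0}) → Ordinal.{0} := fun l => match l with
    | [] => 0
    | p :: l => max (max (nxt θ G en (l.map Prod.snd) p.2) (dl (l.map Prod.snd))) (st l p.2)
  have hdom : ∀ q, dom θ G en q ≤ θ := by
    intro q; unfold dom; split_ifs
    · exact (h.G3 _).le
    · exact le_rfl
  obtain ⟨B, hB, hB2⟩ := bddN θ h.cofTi G h.G3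
  obtain ⟨I, I1, I2, I3, I4⟩ := h.clo u (by
    rintro (_ | ⟨p, l⟩) _
    · exact h0
    · exact max_lt (max_lt ((h.toHG.nxt_dom _ _).trans_le (hdom _)) (dl1 _)) (st1 _ _)) B hB
  obtain ⟨j0, hj0, hj02⟩ := bddN θ h.cofTi I I2
  have hb : ∀ x ∈ range I, x < j0 := by rintro _ ⟨n, rfl⟩; exact hj02 n
  set i := ssup (range I) with hi
  have hiθ : i < θ := (ssup_le hb).trans_lt hj0
  have hIi : ∀ j, I j < i := fun j => lt_ssup hb ⟨j, rfl⟩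
  have hcof : ∀ x < i, ∃ j, x < I j := by
    intro x hx
    obtain ⟨_, ⟨j, rfl⟩, hj⟩ := exists_of_lt_ssup hx
    exact ⟨j + 1, hj.trans_lt (I1 (Nat.lt_succ_self j))⟩
  have hlist : ∀ l : List (ℕ × Ordinal.{0}), (∀ p ∈ l, p.2 < i) → ∃ j, ∀ p ∈ l, p.2 < I j := by
    intro l hl
    induction l with
    | nil => exact ⟨0, by simp⟩
    | cons p l ih =>
      obtain ⟨j, hj⟩ := ih (fun q hq => hl q (List.mem_cons_of_mem _ hq))
      obtain ⟨j', hj'⟩ := hcof p.2 (hl p List.mem_cons_self)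
      refine ⟨max j j', fun q hq => ?_⟩
      rcases List.mem_cons.1 hq with rfl | hq
      · exact hj'.trans_le (I1.monotone (le_max_right _ _))
      · exact (hj q hq).trans_le (I1.monotone (le_max_left _ _))
  have hui : ∀ l : List (ℕ × Ordinal.{0}), (∀ p ∈ l, p.2 < i) → u l < i := by
    intro l hl
    obtain ⟨j, hj⟩ := hlist l hl
    exact (I4 j l hj).trans (hIi _)
  have hu2 : ∀ l : List (ℕ × Ordinal.{0}), (∀ p ∈ l, p.2 < i) → ∀ η < i,
      (nxt θ G en (l.map Prod.snd) η < i ∧ dl (l.map Prod.snd) < i) ∧ st l η < i := by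
    intro l hl η hη
    have := hui ((0, η) :: l) (by
      intro p hp
      rcases List.mem_cons.1 hp with rfl | hp
      · exact hη
      · exact hl p hp)
    simp only [u, max_lt_iff] at this
    exact this
  have hmap : ∀ q : Nd, (∀ x ∈ q, x < i) → ∃ l : List (ℕ × Ordinal.{0}), (∀ p ∈ l, p.2 < i) ∧
      l.map Prod.snd = q := by
    intro q hq
    refine ⟨q.map (fun x => (0, x)), ?_, ?_⟩
    · intro p hp
      obtain ⟨x, hx, rfl⟩ := List.mem_map.1 hp
      exact hq x hx
    · rw [List.map_map]; exact List.map_id q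
  have h0i : 0 < i := (zero_le).trans_lt (hIi 0)
  refine ⟨i, hiθ, I, I1, hIi, hcof, ?_, ?_, ?_, ?_⟩
  · intro k; exact ((hB2 k).le.trans I3).trans (hIi 0).le
  · intro q hq η hη
    obtain ⟨l, hl, rfl⟩ := hmap q hq
    exact (hu2 l hl η hη).1.1
  · intro q hq x hx
    obtain ⟨l, hl, rfl⟩ := hmap q hq
    exact (dl2 _ x hx).trans (hu2 l hl 0 h0i).1.2
  · intro l hl η hη
    obtain ⟨M, hM⟩ := st2 l η
    obtain ⟨M', hM'⟩ := h.f1 _ _ (hu2 l hl η hη).2 hiθ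
    exact ⟨max M M', fun k hk n => (hM k (le_of_max_le_left hk) n).trans (hM' k (le_of_max_le_right hk))⟩

theorem dec_lt {i : Ordinal.{0}} (h0 : 0 < i) (l : List (ℕ × Ordinal.{0})) (hl : ∀ p ∈ l, p.2 < i) (n : ℕ) :
    dec l n < i := by
  induction l with
  | nil => exact h0
  | cons p l ih =>
    unfold dec
    by_cases hn : n = p.1
    · subst hn; rw [Function.update_self]; exact hl p List.mem_cons_self
    · rw [Function.update_of_ne hn]; exact ih (fun q hq => hl q (List.mem_cons_of_mem _ hq))

theorem H3.exists_e {μ G f} (h : H3 μ G f) (en : Nd → ℕ → Ordinal.{0})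
    (hen : ∀ q, ∃ δ < (Order.succ μ).ord, ∀ x ∈ range (en q), x < δ) :
    ∃ i < (Order.succ μ).ord, ∃ e : ℕ → Ordinal.{0}, (∀ n, e n < i) ∧
      (∀ x < i, ∃ n, n % 2 = 1 ∧ x < e n) ∧ (∀ k, G k ≤ i) ∧
      (∀ q : Nd, (∀ x ∈ q, x < i) → ∀ η < i, nxt (Order.succ μ).ord G en q η < i) ∧
      (∀ q : Nd, (∀ x ∈ q, x < i) → ∀ x ∈ range (en q), x < i) ∧
      ∃ M, ∀ k ≥ M, GE (Order.succ μ).ord G en e k < f i k := by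
  obtain ⟨i, hi, I, I1, I2, I3, c1, c2, c3, c4⟩ := h.lemC en hen
  have h0i : 0 < i := (zero_le).trans_lt (I2 0)
  choose! M hM using c4
  let S : ℕ → List (ℕ × Ordinal.{0}) × ℕ := fun j => Nat.rec ([], 0)
    (fun j s => ((2 * (M s.1 (I j) + s.2) + 1, I j) :: s.1, 2 * (M s.1 (I j) + s.2) + 1)) j
  let ns : ℕ → ℕ := fun j => 2 * (M (S j).1 (I j) + (S j).2) + 1
  have hS : ∀ j, S (j + 1) = ((ns j, I j) :: (S j).1, ns j) := fun j => rfl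
  have hns : ∀ j, ns j < ns (j + 1) := by
    intro j
    have : ns (j + 1) = 2 * (M (S (j+1)).1 (I (j+1)) + (S (j+1)).2) + 1 := rfl
    rw [this, show (S (j+1)).2 = ns j by rw [hS]]
    omega
  have hnm : StrictMono ns := strictMono_nat_of_lt_succ hns
  have hSi : ∀ j, ∀ p ∈ (S j).1, p.2 < i := by
    intro j
    induction j with
    | zero => intro p hp; exact absurd hp (by simp [S])
    | succ j ih =>
      rw [hS]
      intro p hp
      rcases List.mem_cons.1 hp with rfl | hp
      · exact I2 j
      · exact ih p hp
  let E : ℕ → ℕ → Ordinal.{0} := fun j => dec (S j).1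
  have hE : ∀ j, E (j + 1) = Function.update (E j) (ns j) (I j) := by
    intro j
    simp only [E, hS, dec]
  have hst : ∀ j n d, n < ns j → E (j + d) n = E j n := by
    intro j n d hn
    induction d with
    | zero => rfl
    | succ d ih =>
      rw [← add_assoc, hE, Function.update_of_ne, ih]
      exact (hn.trans_le (hnm.monotone (by omega))).ne
  let e : ℕ → Ordinal.{0} := fun n => E (n + 1) n
  have he : ∀ j n, n < ns j → e n = E j n := by
    intro j n hn
    rcases le_total j (n + 1) with hj | hj
    · have := hst j n (n + 1 - j) hn
      rw [show j + (n + 1 - j) = n + 1 by omega] at this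
      exact this
    · have h1 : n < ns (n + 1) := (Nat.lt_succ_self n).trans_le (hnm.id_le (n + 1))
      have := hst (n + 1) n (j - (n + 1)) h1
      rw [show n + 1 + (j - (n + 1)) = j by omega] at this
      exact this.symm
  refine ⟨i, hi, e, fun n => dec_lt h0i (S (n+1)).1 (hSi (n+1)) n, ?_, c1, c2, c3, ns 0 + 1, ?_⟩
  · intro x hx
    obtain ⟨j, hj⟩ := I3 x hx
    refine ⟨ns j, ?_, ?_⟩
    · simp only [ns]; omega
    · rw [he (j + 1) (ns j) (hns j), hE, Function.update_self]; exact hj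
  · intro k hk
    have hex : ∃ j, k ≤ ns j := ⟨k, hnm.id_le k⟩
    classical
    obtain ⟨j, hj⟩ : ∃ j, Nat.find hex = j + 1 := by
      refine Nat.exists_eq_succ_of_ne_zero ?_
      intro h0
      have := Nat.find_spec hex
      rw [h0] at this
      omega
    have h1 : k ≤ ns (j + 1) := hj ▸ Nat.find_spec hex
    have h2 : ns j < k := not_le.1 (Nat.find_min hex (by omega))
    rw [GE_congr (fun n hn => he (j + 1) n (hn.trans_le h1)), hE]
    refine hM _ (hSi j) _ (I2 j) k ?_ _
    have : M (S j).1 (I j) ≤ ns j := by simp only [ns]; omega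
    exact this.trans h2.le

theorem drop_node (t : ℕ → Nd) (b : ℕ → Ordinal.{0}) (h : ∀ k, t (k + 1) = b k :: t k) (l m : ℕ) (hm : m ≤ l) :
    (t l).drop (l - m) = t m := by
  induction l with
  | zero =>
    have : m = 0 := by omega
    subst this; simp
  | succ l ih =>
    rcases hm.eq_or_lt with e | e
    · subst e; simp
    · rw [h, show l + 1 - m = (l - m) + 1 by omega, List.drop_succ_cons]
      exact ih (by omega)

theorem suffix_node (t : ℕ → Nd) (b : ℕ → Ordinal.{0}) (h : ∀ k, t (k + 1) = b k :: t k) {l m : ℕ} (hm : m ≤ l) :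
    t m <:+ t l := by
  rw [← drop_node t b h l m hm]; exact List.drop_suffix _ _

theorem H3.stat {μ G f} (h : H3 μ G f) : StatFam (Iio (Order.succ μ).ord) (Afam μ G f) := by
  classical
  refine ⟨fun a ha => ⟨ha.1.1, ha.1.2.1⟩, fun 𝒞 hC => ?_⟩
  set θ := (Order.succ μ).ord with hθ
  have hg : HG θ G := h.toHG
  obtain ⟨en, en1, en2, en3⟩ := exists_en θ (pos_of_cof h.cofTi) 𝒞 hC
  obtain ⟨i, hi, e, e1, e2, c1, c2, c3, M, hM⟩ := h.exists_e en (fun q =>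
    bddN θ h.cofTi (en q) (fun n => (hC.1 (en1 q)).1 ⟨n, rfl⟩) |>.imp fun δ hδ => ⟨hδ.1, by
      rintro _ ⟨n, rfl⟩; exact hδ.2 n⟩)
  let et : Nd → Ordinal.{0} := fun q => if QQ en q then f i q.length else e q.length
  let t : ℕ → Nd := fun k => Nat.rec [] (fun _ q => nxt θ G en q (et q) :: q) k
  let b : ℕ → Ordinal.{0} := fun k => nxt θ G en (t k) (et (t k))
  have ht : ∀ k, t (k + 1) = b k :: t k := fun k => rfl
  have hlen : ∀ k, (t k).length = k := by
    intro k
    induction k with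
    | zero => rfl
    | succ k ih => rw [ht, List.length_cons, ih]
  have hetd : ∀ k, et (t k) < dom θ G en (t k) := by
    intro k
    simp only [et, dom]
    split_ifs
    · exact h.f0 i hi _
    · exact (e1 _).trans hi
  have hvalid : ∀ k, Valid θ G en (t k) := by
    intro k
    induction k with
    | zero => exact hg.valid_nil
    | succ k ih => exact (hg.nxt_spec ih (hetd k)).2.2
  have hb : ∀ k, et (t k) ≤ b k ∧ b k < dom θ G en (t k) := fun k =>
    ⟨(hg.nxt_spec (hvalid k) (hetd k)).1, (hg.nxt_spec (hvalid k) (hetd k)).2.1⟩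
  have hent : ∀ k, ∀ x ∈ t k, x < i := by
    intro k
    induction k with
    | zero => intro x hx; exact absurd hx (by simp [t])
    | succ k ih =>
      rw [ht]
      intro x hx
      rcases List.mem_cons.1 hx with rfl | hx
      · by_cases hQ : QQ en (t k)
        · have := (hb k).2
          rw [dom, if_pos hQ] at this
          exact this.trans_le (c1 _)
        · refine c2 _ ih _ ?_
          simp only [et, if_neg hQ]
          exact e1 _
      · exact ih x hx
  have hbi : ∀ k, b k < i := fun k => hent (k + 1) _ (by rw [ht]; exact List.mem_cons_self)
  have hcon : ∀ k, Con θ G en e (t k) := by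
    intro k
    induction k with
    | zero => exact trivial
    | succ k ih =>
      rw [ht]
      refine ⟨ih, ?_⟩
      by_cases hQ : QQ en (t k)
      · left
        have := (hb k).2
        rw [dom, if_pos hQ] at this
        exact ⟨hQ, this⟩
      · right
        refine ⟨hQ, ?_⟩
        simp only [b, et, if_neg hQ]
  have hmono : ∀ k l, k ≤ l → range (en (t k)) ⊆ range (en (t l)) := by
    intro k l hkl
    induction l, hkl using Nat.le_induction with
    | base => exact subset_rfl
    | succ l _ ih => exact ih.trans (en2 _ _)
  let a : Set Ordinal.{0} := ⋃ k, range (en (t k))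
  have haC : a ∈ 𝒞 := by
    have := hC.2.1 (range fun k => range (en (t k))) (by rintro _ ⟨k, rfl⟩; exact en1 _) (range_nonempty _)
      (by
        rintro _ ⟨k, rfl⟩ _ ⟨l, rfl⟩ _
        rcases le_total k l with hkl | hkl
        · exact Or.inl (hmono k l hkl)
        · exact Or.inr (hmono l k hkl)) (countable_range _)
    rwa [sUnion_range] at this
  have hai : ∀ x ∈ a, x < i := by
    intro x hx
    obtain ⟨k, hk⟩ := mem_iUnion.1 hx
    exact c3 _ (hent k) x hk
  have hba : ∀ k, b k ∈ a := by
    intro k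
    refine mem_iUnion.2 ⟨k + 1, ?_⟩
    rw [ht]
    exact en3 _ _ ((hbi k).trans hi)
  have hcof : ∀ x < i, ∃ z ∈ a, x < z := by
    intro x hx
    obtain ⟨n, hn, hxn⟩ := e2 x hx
    refine ⟨b n, hba n, hxn.trans_le ?_⟩
    have hQ : ¬ QQ en (t n) := by
      rintro ⟨m, hm⟩
      rw [hlen] at hm
      unfold code at hm
      omega
    have := (hb n).1
    simp only [et, if_neg hQ, hlen] at this
    exact this
  have hssup : ssup a = i := by
    apply le_antisymm (ssup_le hai)
    by_contra hc
    push Not at hc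
    obtain ⟨z, hz, hz2⟩ := hcof _ hc
    exact absurd (lt_ssup hai hz) (not_lt.2 hz2.le)
  have hinf : a.Infinite := by
    intro hfin
    obtain ⟨x, hx, hx2⟩ := hfin.exists_maximal ⟨b 0, hba 0⟩
    obtain ⟨z, hz, hz2⟩ := hcof x (hai x hx)
    exact absurd (hx2 hz hz2.le) (not_le.2 hz2)
  let y : ℕ → Ordinal.{0} := fun k => en (t (Nat.unpair k).1) (Nat.unpair k).2
  have hyr : range y = a := by
    ext x
    constructor
    · rintro ⟨k, rfl⟩
      exact mem_iUnion.2 ⟨_, _, rfl⟩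
    · intro hx
      obtain ⟨k, n, hk⟩ := mem_iUnion.1 hx
      refine ⟨Nat.pair k n, ?_⟩
      simp only [y, Nat.unpair_pair]
      exact hk
  have hcode : ∀ l n, n ≤ l → code n (yv en (t l)) = code n y := by
    intro l n hn
    apply code_congr
    intro k hk
    have : (Nat.unpair k).1 ≤ l := (Nat.unpair_left_le k).trans (by omega)
    simp only [yv, y, hlen]
    rw [drop_node t b ht l _ this]
  have hQK : ∀ l, QQ en (t l) ↔ l ∈ Kset y := by
    intro l
    constructor
    · rintro ⟨n, hn⟩
      rw [hlen] at hn
      have : n ≤ l := hn ▸ le_code _ _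
      exact ⟨n, by rw [← hcode l n this]; exact hn⟩
    · rintro ⟨n, hn⟩
      have : n ≤ l := hn ▸ le_code _ _
      exact ⟨n, by rw [hlen, hcode l n this]; exact hn⟩
  refine ⟨a, ⟨⟨(hC.1 haC).1, (hC.1 haC).2, hinf⟩, y, hyr, M, ?_⟩, haC⟩
  intro l hl
  rw [← hQK]
  constructor
  · rintro ⟨x, hx, hx2, hx3⟩
    by_contra hQ
    rw [hssup] at hx2
    obtain ⟨k, hk⟩ := mem_iUnion.1 hx
    have hk' : x ∈ range (en (t (max k (l + 1)))) := hmono _ _ (le_max_left _ _) hk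
    have hsuf : b l :: t l <:+ t (max k (l + 1)) := by
      rw [← ht]; exact suffix_node t b ht (le_max_right k (l + 1))
    have h1 := hg.valid_bound (hvalid _) hsuf hQ hk' (by rw [hlen]; exact hx3)
    have h2 := (hg.GE_spec (en := en) e l).2 (t l) ⟨hlen l, hcon l⟩
    exact absurd ((h1.trans h2).trans (hM l hl)) (not_lt.2 hx2)
  · intro hQ
    refine ⟨b l, hba l, ?_, ?_⟩
    · rw [hssup]
      have := (hb l).1
      simp only [et, if_pos hQ, hlen] at this
      exact this
    · have := (hb l).2
      rw [dom, if_pos hQ, hlen] at this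
      exact this

end M6

/-- if `μ` is singular of cofinality `ℵ₀` and `pp(μ) > μ⁺` in the sense
that some strictly increasing sequence `⟨λ_n⟩` of regular cardinals `> ℵ₁` with
supremum `μ` carries a witness `⟨f_α : α < μ⁺⁺⟩` of
`μ⁺⁺ = tcf(∏ λ_n, <_{J^bd_ω})`, then some stationary `𝒜 ⊆ [μ⁺]^{ℵ₀}` does not
reflect in any uncountable `A ⊆ μ⁺` of cardinality `≤ μ`. -/
theorem stmt9 (μ : Cardinal.{0}) (lamseq : ℕ → Cardinal.{0})
    (f : Ordinal.{0} → ℕ → Ordinal.{0})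
    (hμ : ℵ₀ < μ) (hcf : μ.ord.cof = ℵ₀)
    (hreg : ∀ n : ℕ, (lamseq n).IsRegular)
    (hbig : ∀ n : ℕ, Cardinal.aleph 1 < lamseq n)
    (hmono : StrictMono lamseq)
    (hsup : ⨆ n : ℕ, lamseq n = μ)
    (hf : TcfWitness (Order.succ (Order.succ μ)) lamseq f) :
    ∃ 𝒜 : Set (Set Ordinal.{0}), 𝒜 ⊆ ctblInf (Set.Iio (Order.succ μ).ord) ∧
      StatFam (Set.Iio (Order.succ μ).ord) 𝒜 ∧
      ∀ A : Set Ordinal.{0}, A ⊆ Set.Iio (Order.succ μ).ord → ¬ A.Countable →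
        #A ≤ Cardinal.lift.{1,0} μ → ¬ Reflects 𝒜 A := by
  have h1 : H1 μ lamseq :=
    ⟨hμ, hreg, fun n => (Cardinal.aleph0_lt_aleph_one).trans (hbig n), hmono, hsup⟩
  obtain ⟨F, hF1, hF2⟩ := free_seq h1 f hf
  obtain ⟨G, f2, h3⟩ := (H2.mk h1 hF1 hF2 : H2 μ lamseq F).toH3 hbig
  exact ⟨Afam μ G f2, fun a ha => ha.1, h3.stat, fun A hA hAc hAμ => h3.nonrefl A hA hAc hAμ⟩

end ReflSCH
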